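/- There exists an absolute constant C > 0 such that the following holds. Let (Ω, μ) be a probability space and (φ_j)_{j=1}^n an orthonormal system in L₂(Ω, μ) (complex-valued) with ‖φ_j‖_{L∞} ≤ L for all 1 ≤ j ≤ n. For every integer k with 2 ≤ k < n there exists a subset I ⊆ {1, …, n} with |I| ≥ n − k such that for every a = (a_i) ∈ ℂⁿ, ‖∑_{i ∈ I} a_i φ_i‖_{L₂} ≤ C · μ · (max(log μ, 1))^{5/2} · ‖∑_{i ∈ I} a_i φ_i‖_{L₁}, where μ = L·√(n/k)·√(log k). -/

import Mathlib

open MeasureTheory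

noncomputable section

/-- sign attached to a Boolean -/
def sg (b : Bool) : ℝ := if b then 1 else -1

lemma sg_sq (b : Bool) : sg b * sg b = 1 := by cases b <;> simp [sg]

lemma sg_not (b : Bool) : sg (!b) = - sg b := by cases b <;> simp [sg]

lemma sg_abs (b : Bool) : |sg b| = 1 := by cases b <;> simp [sg]

lemma rad_mgf {n : ℕ} (c : Fin n → ℝ) :
    ∑ g : Fin n → Bool, Real.exp (∑ j, sg (g j) * c j) ≤
      2 ^ n * Real.exp ((∑ j, c j ^ 2) / 2) := by
  have h1 : ∑ g : Fin n → Bool, Real.exp (∑ j, sg (g j) * c j)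
      = ∏ j, ∑ b : Bool, Real.exp (sg b * c j) := by
    rw [Finset.prod_univ_sum]
    simp only [Real.exp_sum, Fintype.piFinset_univ]
  rw [h1]
  have h2 : (2:ℝ) ^ n * Real.exp ((∑ j, c j ^ 2) / 2) = ∏ j : Fin n, (2 * Real.exp (c j ^ 2 / 2)) := by
    rw [Finset.prod_mul_distrib, Finset.sum_div, Real.exp_sum]
    simp
  rw [h2]
  apply Finset.prod_le_prod
  · intro j _; positivity
  · intro j _
    have := Real.cosh_le_exp_half_sq (c j)
    rw [Real.cosh_eq] at this
    simp [sg]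
    linarith

lemma rad_cross {n : ℕ} (i j : Fin n) (hij : i ≠ j) :
    ∑ g : Fin n → Bool, sg (g i) * sg (g j) = 0 := by
  have : ∑ g : Fin n → Bool, sg (g i) * sg (g j) = ∑ g : Fin n → Bool, -(sg (g i) * sg (g j)) := by
    refine Finset.sum_bij' (fun g _ => Function.update g i (!(g i)))
      (fun g _ => Function.update g i (!(g i))) ?_ ?_ ?_ ?_ ?_
    · simp
    · simp
    · intro g _; simp
    · intro g _; simp
    · intro g _
      rw [Function.update_self, Function.update_of_ne (Ne.symm hij), sg_not]
      ring
  rw [Finset.sum_neg_distrib] at this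
  linarith

lemma rad_sq {n : ℕ} (c : Fin n → ℝ) :
    ∑ g : Fin n → Bool, (∑ j, sg (g j) * c j) ^ 2 = 2 ^ n * ∑ j, c j ^ 2 := by
  have h : ∀ g : Fin n → Bool, (∑ j, sg (g j) * c j) ^ 2
      = ∑ i, ∑ j, (sg (g i) * sg (g j)) * (c i * c j) := by
    intro g
    rw [sq, Finset.sum_mul_sum]
    refine Finset.sum_congr rfl fun i _ => Finset.sum_congr rfl fun j _ => by ring
  simp_rw [h]
  rw [Finset.sum_comm, Finset.mul_sum]
  refine Finset.sum_congr rfl fun i _ => ?_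
  rw [Finset.sum_comm]
  simp_rw [← Finset.sum_mul]
  rw [Finset.sum_eq_single i]
  · simp [sg_sq]; ring
  · intro j _ hj
    rw [rad_cross i j (Ne.symm hj), zero_mul]
  · simp

lemma rad_neg_count {n : ℕ} (c : Fin n → ℝ) (t : ℝ) :
    (Finset.univ.filter fun g : Fin n → Bool => ∑ j, sg (g j) * c j ≤ -t).card =
    (Finset.univ.filter fun g : Fin n → Bool => t ≤ ∑ j, sg (g j) * c j).card := by
  apply Finset.card_bij' (fun g _ => fun j => !(g j)) (fun g _ => fun j => !(g j))
  · intro g hg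
    simp [sg_not] at hg ⊢; linarith
  · intro g hg
    simp [sg_not] at hg ⊢; linarith
  · intro g _; simp
  · intro g _; simp

lemma rad_pz_norm {n : ℕ} (c : Fin n → ℝ) (hc : ∑ j, c j ^ 2 = 1) :
    (2:ℝ) ^ n ≤ 300 * (Finset.univ.filter fun g : Fin n → Bool => 1 / 2 ≤ ∑ j, sg (g j) * c j).card := by
  set Y : (Fin n → Bool) → ℝ := fun g => ∑ j, sg (g j) * c j with hY
  have e2 : ∑ g, Y g ^ 2 = 2 ^ n := by rw [hY, rad_sq, hc, mul_one]
  have m1 : ∑ g, Real.exp (Y g) ≤ 2 ^ n * Real.exp (1 / 2) := by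
    have := rad_mgf c; rwa [hc] at this
  have m2 : ∑ g, Real.exp (-Y g) ≤ 2 ^ n * Real.exp (1 / 2) := by
    have := rad_mgf (fun j => - c j)
    simp only [mul_neg, Finset.sum_neg_distrib, even_two.neg_pow] at this
    rwa [hc] at this
  have hexp : Real.exp (1 / 2) ≤ 1.66 := by
    have h1 : Real.exp (1/2) ^ 2 = Real.exp 1 := by rw [← Real.exp_nat_mul]; norm_num
    have h2 := Real.exp_one_lt_d9
    have h3 := Real.exp_pos (1/2)
    nlinarith
  have p4 : ∀ g, Y g ^ 4 ≤ 24 * (Real.exp (Y g) + Real.exp (-Y g)) := by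
    intro g
    have h := Real.pow_div_factorial_le_exp |Y g| (abs_nonneg _) 4
    have h4 : |Y g| ^ 4 = Y g ^ 4 := by rw [← abs_pow]; exact abs_of_nonneg (by positivity)
    rw [h4] at h
    have h5 : Real.exp |Y g| ≤ Real.exp (Y g) + Real.exp (-Y g) := by
      rcases abs_cases (Y g) with ⟨h, _⟩ | ⟨h, _⟩ <;> rw [h] <;>
        linarith [Real.exp_pos (Y g), Real.exp_pos (-Y g)]
    have : ((4:ℕ).factorial : ℝ) = 24 := by norm_num [Nat.factorial]
    rw [this, div_le_iff₀ (by norm_num)] at h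
    linarith
  have e4 : ∑ g, Y g ^ 4 ≤ 80 * 2 ^ n := by
    calc ∑ g, Y g ^ 4 ≤ ∑ g, 24 * (Real.exp (Y g) + Real.exp (-Y g)) :=
          Finset.sum_le_sum fun g _ => p4 g
      _ = 24 * (∑ g, Real.exp (Y g) + ∑ g, Real.exp (-Y g)) := by
          rw [← Finset.mul_sum, Finset.sum_add_distrib]
      _ ≤ 80 * 2 ^ n := by
          have : (0:ℝ) < 2 ^ n := by positivity
          nlinarith
  -- pointwise indicator bound
  have key : ∀ g, 0.018 * (Y g ^ 2 - 1/4) - 0.000081 * (Y g ^ 2 - 1/4) ^ 2 ≤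
      (if 1/2 ≤ Y g then (1:ℝ) else 0) + (if Y g ≤ -(1/2) then (1:ℝ) else 0) := by
    intro g
    have hle1 : 0.018 * (Y g ^ 2 - 1/4) - 0.000081 * (Y g ^ 2 - 1/4) ^ 2 ≤ 1 := by
      nlinarith [sq_nonneg (0.009 * (Y g ^ 2 - 1/4) - 1)]
    by_cases h1 : 1/2 ≤ Y g
    · rw [if_pos h1]; split_ifs <;> linarith
    · by_cases h2 : Y g ≤ -(1/2)
      · rw [if_pos h2]; split_ifs; linarith
      · rw [if_neg h1, if_neg h2]
        push Not at h1 h2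
        have : Y g ^ 2 ≤ 1/4 := by nlinarith
        nlinarith [sq_nonneg (Y g ^ 2 - 1/4)]
  have hs := Finset.sum_le_sum (s := Finset.univ) fun g _ => key g
  rw [Finset.sum_add_distrib, Finset.sum_boole, Finset.sum_boole] at hs
  have hn := rad_neg_count c (1/2)
  have hn' : ((Finset.univ.filter fun g : Fin n → Bool => Y g ≤ -(1/2)).card : ℝ) =
    (Finset.univ.filter fun g : Fin n → Bool => 1/2 ≤ Y g).card := by exact_mod_cast hn
  rw [hn'] at hs
  have hl : ∑ g, (0.018 * (Y g ^ 2 - 1/4) - 0.000081 * (Y g ^ 2 - 1/4) ^ 2) =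
      0.018 * (∑ g, Y g ^ 2) - 0.0045 * 2 ^ n - 0.000081 * (∑ g, Y g ^ 4)
       + 0.0000405 * (∑ g, Y g ^ 2) - 0.0000050625 * 2 ^ n := by
    have : ∀ g, (0.018 * (Y g ^ 2 - 1/4) - 0.000081 * (Y g ^ 2 - 1/4) ^ 2) =
      0.018 * Y g ^ 2 - 0.0045 - 0.000081 * Y g ^ 4 + 0.0000405 * Y g ^ 2 - 0.0000050625 := by
      intro g; ring
    simp_rw [this]
    simp only [Finset.sum_sub_distrib, Finset.sum_add_distrib, ← Finset.mul_sum,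
      Finset.sum_const, Finset.card_univ, Fintype.card_pi, nsmul_eq_mul]
    simp
    ring
  rw [hl, e2] at hs
  have : (0:ℝ) < 2 ^ n := by positivity
  nlinarith

lemma rad_pz {n : ℕ} (c : Fin n → ℝ) (ρ : ℝ) (hρ : 0 ≤ ρ) (hc : ρ ^ 2 ≤ ∑ j, c j ^ 2) :
    (2:ℝ) ^ n ≤ 300 * (Finset.univ.filter fun g : Fin n → Bool => ρ / 2 ≤ ∑ j, sg (g j) * c j).card := by
  rcases hρ.eq_or_lt with h0 | hpos
  · -- count of nonnegative sums
    subst h0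
    have hn := rad_neg_count c 0
    have hcov : (Finset.univ : Finset (Fin n → Bool)).card ≤
        (Finset.univ.filter fun g : Fin n → Bool => ∑ j, sg (g j) * c j ≤ -0).card +
        (Finset.univ.filter fun g : Fin n → Bool => 0 ≤ ∑ j, sg (g j) * c j).card := by
      rw [← Finset.card_union_add_card_inter]
      refine le_trans (Finset.card_le_card ?_) (Nat.le_add_right _ _)
      intro g _
      simp
      exact le_total _ _
    rw [hn] at hcov
    simp at hcov
    have : (2:ℝ)^n ≤ ((Finset.univ.filter fun g : Fin n → Bool => 0 ≤ ∑ j, sg (g j) * c j).card +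
      (Finset.univ.filter fun g : Fin n → Bool => 0 ≤ ∑ j, sg (g j) * c j).card : ℕ) := by
      exact_mod_cast hcov
    push_cast at this
    simp only [zero_div]
    linarith
  · set s := Real.sqrt (∑ j, c j ^ 2) with hs
    have hspos : 0 < s := Real.sqrt_pos.2 (lt_of_lt_of_le (by positivity) hc)
    have hs2 : s ^ 2 = ∑ j, c j ^ 2 := Real.sq_sqrt (Finset.sum_nonneg fun _ _ => sq_nonneg _)
    have hρs : ρ ≤ s := Real.le_sqrt_of_sq_le hc
    have h := rad_pz_norm (fun j => c j / s) (by
      simp_rw [div_pow]; rw [← Finset.sum_div, ← hs2]; field_simp)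
    refine h.trans ?_
    gcongr 300 * ?_
    norm_cast
    apply Finset.card_le_card
    intro g hg
    simp only [Finset.mem_filter, Finset.mem_univ, true_and] at hg ⊢
    have : ∑ j, sg (g j) * (c j / s) = (∑ j, sg (g j) * c j) / s := by
      rw [Finset.sum_div]; refine Finset.sum_congr rfl fun j _ => by ring
    rw [this, le_div_iff₀ hspos] at hg
    linarith

end

open MeasureTheory

noncomputable section

/-- expected total penalty of the continuations of a history -/
def pot {α : Type} [Fintype α] (w : α → ℝ) (b : List α → ℝ) : ℕ → List α → ℝ
  | 0, l => b l
  | T + 1, l => b l + ∑ a, w a * pot w b T (a :: l)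

lemma pot_nonneg {α : Type} [Fintype α] (w : α → ℝ) (b : List α → ℝ) (hw : ∀ a, 0 ≤ w a)
    (hb : ∀ l, 0 ≤ b l) : ∀ T l, 0 ≤ pot w b T l := by
  intro T
  induction T with
  | zero => intro l; exact hb l
  | succ T ih =>
    intro l
    exact add_nonneg (hb l) (Finset.sum_nonneg fun a _ => mul_nonneg (hw a) (ih _))

lemma le_pot {α : Type} [Fintype α] (w : α → ℝ) (b : List α → ℝ) (hw : ∀ a, 0 ≤ w a)
    (hb : ∀ l, 0 ≤ b l) (T : ℕ) (l : List α) : b l ≤ pot w b T l := by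
  cases T with
  | zero => exact le_rfl
  | succ T =>
    exact le_add_of_nonneg_right
      (Finset.sum_nonneg fun a _ => mul_nonneg (hw a) (pot_nonneg w b hw hb _ _))

lemma pot_step {α : Type} [Fintype α] (w : α → ℝ) (b : List α → ℝ) (hw : ∀ a, 0 ≤ w a)
    (hb : ∀ l, 0 ≤ b l) (T : ℕ) (l : List α) (Q p : ℝ) (hp : 0 < p)
    (hQ : pot w b (T + 1) l ≤ Q) (A : Finset α) (hA : p ≤ ∑ a ∈ A, w a) :
    ∃ a ∈ A, pot w b T (a :: l) ≤ Q / p := by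
  by_contra hcon
  push Not at hcon
  have hQ0 : 0 ≤ Q := (pot_nonneg w b hw hb _ _).trans hQ
  have h1 : ∑ a ∈ A, w a * pot w b T (a :: l) ≤ Q := by
    refine le_trans ?_ hQ
    refine le_trans (Finset.sum_le_univ_sum_of_nonneg
      fun a => mul_nonneg (hw a) (pot_nonneg w b hw hb _ _)) ?_
    exact le_add_of_nonneg_left (hb l)
  have h2 : ∑ a ∈ A, w a * (Q / p) < ∑ a ∈ A, w a * pot w b T (a :: l) := by
    apply Finset.sum_lt_sum
    · intro a ha; exact mul_le_mul_of_nonneg_left (hcon a ha).le (hw a)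
    · by_contra hh
      push Not at hh
      have : ∀ a ∈ A, w a = 0 := by
        intro a ha
        by_contra hne
        have hpos : 0 < w a := lt_of_le_of_ne (hw a) (Ne.symm hne)
        exact absurd (hh a ha) (not_le.2 (mul_lt_mul_of_pos_left (hcon a ha) hpos))
      rw [Finset.sum_eq_zero this] at hA
      linarith
  rw [← Finset.sum_mul] at h2
  have h3 : p * (Q / p) ≤ (∑ a ∈ A, w a) * (Q / p) :=
    mul_le_mul_of_nonneg_right hA (by positivity)
  rw [mul_div_cancel₀ _ hp.ne'] at h3
  linarith

lemma pot_sum {α β : Type} [Fintype α] [Fintype β] (w : α → ℝ) (b : β → List α → ℝ) :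
    ∀ T l, ∑ e, pot w (b e) T l = pot w (fun l => ∑ e, b e l) T l := by
  intro T
  induction T with
  | zero => intro l; rfl
  | succ T ih =>
    intro l
    simp only [pot]
    rw [Finset.sum_add_distrib, Finset.sum_comm]
    simp_rw [← Finset.mul_sum, ih]

lemma pot_le {α : Type} [Fintype α] (w : α → ℝ) (b : List α → ℝ) (hw : ∀ a, 0 ≤ w a)
    (hw1 : ∑ a, w a = 1) (β : ℕ → ℝ) (hb : ∀ l, b l ≤ β l.length) :
    ∀ T l, pot w b T l ≤ ∑ t ∈ Finset.range (T + 1), β (l.length + t) := by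
  intro T
  induction T with
  | zero => intro l; simpa [pot] using hb l
  | succ T ih =>
    intro l
    rw [Finset.sum_range_succ']
    simp only [pot]
    have h : ∑ a, w a * pot w b T (a :: l) ≤
        ∑ a, w a * ∑ t ∈ Finset.range (T + 1), β (l.length + (t + 1)) := by
      refine Finset.sum_le_sum fun a _ => mul_le_mul_of_nonneg_left ?_ (hw a)
      refine (ih (a :: l)).trans (le_of_eq ?_)
      refine Finset.sum_congr rfl fun t _ => ?_
      congr 1; simp; omega
    rw [← Finset.sum_mul, hw1, one_mul] at h
    have := hb l
    simp only [add_zero]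
    linarith

/-- the chaining estimate along a path -/
lemma chain_bound (I T : ℕ) (f g τ X : ℕ → ℝ) (N : ℕ → ℕ → ℝ) (R D1 D2 : ℝ)
    (hD1 : 0 ≤ D1) (hD2 : 0 ≤ D2)
    (hf0 : 0 ≤ f 0) (hfT : f T ≤ R)
    (hN0 : ∀ s t, 0 ≤ N s t)
    (hN : ∀ s t, s ≤ t → t ≤ T → 2 * N s t ^ 2 ≤ f t - f s)
    (hτ0 : τ 0 = 0)
    (hτ : ∀ t, t < T → τ t ≤ τ (t + 1))
    (hstep : ∀ t, t < T → (τ (t + 1) - τ t) * g t ^ 2 / 8 ≤ f (t + 1) - f t)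
    (hg : ∀ t, 0 ≤ g t) (hg0 : g 0 ≤ 1) (hgT : g T ≤ (1 / 2) ^ I)
    (hgt : ∀ t, t < T → (1 / 2) ^ I < g t)
    (hX : ∀ s t, s < t → t ≤ T → |X t - X s| ≤
      5 / 2 * Real.sqrt (τ t) * (D1 * (g s + g t) + D2 * N s t * (g s + g t))) :
    |X T - X 0| ≤ 25 * D1 * Real.sqrt (I * R) + 18 * D2 * R := by
  classical
  have hex : ∀ i : ℕ, ∃ t, g t ≤ (1 / 2) ^ i ∨ t = T := fun i => ⟨T, Or.inr rfl⟩
  set tt : ℕ → ℕ := fun i => Nat.find (hex i) with htt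
  have tt_le : ∀ i, tt i ≤ T := fun i => Nat.find_min' (hex i) (Or.inr rfl)
  have tt_lt : ∀ i t, t < tt i → (1 / 2) ^ i < g t := by
    intro i t ht
    have := Nat.find_min (hex i) ht
    push Not at this
    exact this.1
  have tt_g : ∀ i, i ≤ I → g (tt i) ≤ (1 / 2) ^ i := by
    intro i hi
    rcases Nat.find_spec (hex i) with h | h
    · exact h
    · have : g (tt i) = g T := by rw [htt]; simp only; rw [h]
      rw [this]
      exact hgT.trans (pow_le_pow_of_le_one (by norm_num) (by norm_num) hi)
  have tt0 : tt 0 = 0 := by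
    have : tt 0 ≤ 0 := Nat.find_min' (hex 0) (Or.inl (by simpa using hg0))
    omega
  have ttI : tt I = T := by
    apply le_antisymm (tt_le I)
    by_contra h
    push Not at h
    exact absurd (tt_g I le_rfl) (not_le.2 (hgt _ h))
  have tt_mono : ∀ i, i < I → tt i ≤ tt (i + 1) := by
    intro i hi
    by_contra h
    push Not at h
    have h1 := tt_lt i _ h
    have h2 := tt_g (i + 1) hi
    have h3 : ((1:ℝ) / 2) ^ (i + 1) ≤ (1 / 2) ^ i :=
      pow_le_pow_of_le_one (by norm_num) (by norm_num) (Nat.le_succ i)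
    linarith
  have τmono : ∀ s t, s ≤ t → t ≤ T → τ s ≤ τ t := by
    intro s t hst
    induction t, hst using Nat.le_induction with
    | base => intro _; exact le_rfl
    | succ t hst ih => intro h; exact (ih (by omega)).trans (hτ t (by omega))
  have τnn : ∀ t, t ≤ T → 0 ≤ τ t := fun t ht => hτ0 ▸ τmono 0 t (Nat.zero_le _) ht
  have τgrow : ∀ i s t, s ≤ t → t ≤ tt i → (τ t - τ s) * (1 / 4) ^ i ≤ 8 * (f t - f s) := by
    intro i s t hst
    induction t, hst using Nat.le_induction with
    | base => intro _; simp
    | succ t hst ih =>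
      intro h
      have h1 := ih (by omega)
      have hT : t < T := by have := tt_le i; omega
      have h2 := hstep t hT
      have h3 := tt_lt i t (by omega)
      have h4 : ((1:ℝ) / 4) ^ i ≤ g t ^ 2 := by
        have : ((1:ℝ) / 4) ^ i = ((1 / 2) ^ i) ^ 2 := by
          rw [← pow_mul, mul_comm, pow_mul]; norm_num
        rw [this]
        exact pow_le_pow_left₀ (by positivity) h3.le 2
      have h5 : (τ (t + 1) - τ t) * (1 / 4) ^ i ≤ (τ (t + 1) - τ t) * g t ^ 2 :=
        mul_le_mul_of_nonneg_left h4 (by linarith [hτ t hT])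
      linarith
  -- u i
  set u : ℕ → ℝ := fun i => Real.sqrt (τ (tt i)) * (1 / 2) ^ i with hu
  have u0 : ∀ i, 0 ≤ u i := fun i => by positivity
  have u2 : ∀ i, u i ^ 2 = τ (tt i) * (1 / 4) ^ i := by
    intro i
    simp only [hu]
    rw [mul_pow, Real.sq_sqrt (τnn _ (tt_le i)), ← pow_mul, mul_comm i 2, pow_mul]; norm_num
  have urec : ∀ i, i < I → u (i + 1) ^ 2 ≤ u i ^ 2 / 4 + 8 * (f (tt (i + 1)) - f (tt i)) := by
    intro i hi
    have h := τgrow (i + 1) (tt i) (tt (i + 1)) (tt_mono i hi) le_rfl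
    rw [u2, u2, pow_succ]
    rw [pow_succ] at h
    linarith
  have usum : ∀ i, i ≤ I → ∑ l ∈ Finset.range i, u (l + 1) ^ 2 + u i ^ 2 / 3
      ≤ 32 / 3 * (f (tt i) - f 0) := by
    intro i
    induction i with
    | zero => intro _; rw [tt0]; simp [u2, tt0, hτ0]
    | succ i ih =>
      intro hi
      have h1 := ih (by omega)
      have h2 := urec i (by omega)
      rw [Finset.sum_range_succ]
      linarith
  have Nsum : ∀ i, i ≤ I → ∑ l ∈ Finset.range i, N (tt l) (tt (l + 1)) ^ 2
      ≤ 1 / 2 * (f (tt i) - f 0) := by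
    intro i
    induction i with
    | zero => intro _; rw [tt0]; simp
    | succ i ih =>
      intro hi
      have h1 := ih (by omega)
      have h2 := hN (tt i) (tt (i + 1)) (tt_mono i (by omega)) (tt_le _)
      rw [Finset.sum_range_succ]
      linarith
  have Xsum : ∀ i, i ≤ I → |X (tt i) - X 0| ≤
      ∑ l ∈ Finset.range i, (15 / 2 * D1 * u (l + 1) +
        15 / 2 * D2 * (u (l + 1) * N (tt l) (tt (l + 1)))) := by
    intro i
    induction i with
    | zero => intro _; rw [tt0]; simp
    | succ i ih =>
      intro hi
      have h1 := ih (by omega)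
      rw [Finset.sum_range_succ]
      have h2 : |X (tt (i + 1)) - X (tt i)| ≤ 15 / 2 * D1 * u (i + 1) +
        15 / 2 * D2 * (u (i + 1) * N (tt i) (tt (i + 1))) := by
        rcases (tt_mono i (by omega)).eq_or_lt with he | hlt
        · rw [← he]; simp only [sub_self, abs_zero]
          have := u0 (i+1)
          have := hN0 (tt i) (tt i)
          positivity
        · refine (hX _ _ hlt (tt_le _)).trans ?_
          have g1 := tt_g i (by omega)
          have g2 := tt_g (i + 1) hi
          have hgs : g (tt i) + g (tt (i + 1)) ≤ 3 * (1 / 2) ^ (i + 1) := by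
            rw [pow_succ] at g2 ⊢; linarith
          have hNn := hN0 (tt i) (tt (i + 1))
          have : D1 * (g (tt i) + g (tt (i + 1))) +
              D2 * N (tt i) (tt (i + 1)) * (g (tt i) + g (tt (i + 1))) ≤
              D1 * (3 * (1 / 2) ^ (i + 1)) +
              D2 * N (tt i) (tt (i + 1)) * (3 * (1 / 2) ^ (i + 1)) := by gcongr
          refine (mul_le_mul_of_nonneg_left this (by positivity)).trans (le_of_eq ?_)
          simp only [hu]; ring
      calc |X (tt (i + 1)) - X 0| = |(X (tt i) - X 0) + (X (tt (i + 1)) - X (tt i))| := by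
            congr 1; ring
        _ ≤ _ := abs_add_le _ _
        _ ≤ _ := add_le_add h1 h2
  have hfin := Xsum I le_rfl
  rw [ttI, Finset.sum_add_distrib, ← Finset.mul_sum, ← Finset.mul_sum] at hfin
  have hu1 := usum I le_rfl
  have hn1 := Nsum I le_rfl
  rw [ttI] at hu1 hn1
  have hR : f T - f 0 ≤ R := by linarith
  have hR0 : 0 ≤ R := by
    have := hN 0 T (Nat.zero_le _) le_rfl
    nlinarith [sq_nonneg (N 0 T)]
  set A := ∑ l ∈ Finset.range I, u (l + 1) ^ 2 with hA
  set B := ∑ l ∈ Finset.range I, N (tt l) (tt (l + 1)) ^ 2 with hB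
  have hAR : A ≤ 32 / 3 * R := by have := sq_nonneg (u I); linarith
  have hBR : B ≤ 1 / 2 * R := by linarith
  have hA0 : 0 ≤ A := Finset.sum_nonneg fun _ _ => sq_nonneg _
  have hB0 : 0 ≤ B := Finset.sum_nonneg fun _ _ => sq_nonneg _
  have c1 : ∑ l ∈ Finset.range I, u (l + 1) ≤ 10 / 3 * Real.sqrt (I * R) := by
    have h := sq_sum_le_card_mul_sum_sq (s := Finset.range I) (f := fun l => u (l + 1))
    rw [Finset.card_range] at h
    refine le_trans (le_abs_self _) (abs_le_of_sq_le_sq ?_ (by positivity))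
    rw [mul_pow, Real.sq_sqrt (by positivity)]
    refine h.trans ?_
    have : (I:ℝ) * A ≤ I * (32 / 3 * R) := by gcongr
    have h0 : 0 ≤ (I:ℝ) * R := by positivity
    linarith
  have c2 : ∑ l ∈ Finset.range I, u (l + 1) * N (tt l) (tt (l + 1)) ≤ 12 / 5 * R := by
    have h := Finset.sum_mul_sq_le_sq_mul_sq (Finset.range I) (fun l => u (l + 1))
      (fun l => N (tt l) (tt (l + 1)))
    refine le_trans (le_abs_self _) (abs_le_of_sq_le_sq ?_ (by positivity))
    refine h.trans ?_
    have : A * B ≤ (32 / 3 * R) * (1 / 2 * R) := by gcongr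
    nlinarith [sq_nonneg R]
  calc |X T - X 0| ≤ _ := hfin
    _ ≤ 15 / 2 * D1 * (10 / 3 * Real.sqrt (I * R)) + 15 / 2 * D2 * (12 / 5 * R) := by gcongr
    _ = _ := by ring

end

open MeasureTheory

noncomputable section

/-- a minimiser of `F` on `C` -/
def amin {V : Type} [Zero V] (F : V → ℝ) (C : Set V) : V :=
  open Classical in
  if h : ∃ y ∈ C, ∀ v ∈ C, F y ≤ F v then h.choose else 0

/-- the set of points compatible with a history of moves -/
def gst {V α : Type} [AddCommGroup V] (F : V → ℝ) (T : Set V) (lf : α → V → V → ℝ) (γ : α → ℝ) :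
    List α → Set V
  | [] => T
  | m :: l => gst F T lf γ l ∩
      {v | γ m ≤ lf m (amin F (gst F T lf γ l)) (v - amin F (gst F T lf γ l))}

/-- total cost of a history -/
def tcost {α : Type} (cost : α → ℝ) (l : List α) : ℝ := (l.map cost).sum

lemma amin_spec {V : Type} [NormedAddCommGroup V] [NormedSpace ℝ V] (F : V → ℝ)
    (hFc : Continuous F) (C : Set V) (hC : IsCompact C) (hne : C.Nonempty) :
    amin F C ∈ C ∧ ∀ v ∈ C, F (amin F C) ≤ F v := by
  have h : ∃ y ∈ C, ∀ v ∈ C, F y ≤ F v := by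
    obtain ⟨y, hy, hy'⟩ := hC.exists_isMinOn hne hFc.continuousOn
    exact ⟨y, hy, fun v hv => hy' hv⟩
  unfold amin
  rw [dif_pos h]
  exact h.choose_spec

lemma amin_gain {V : Type} [NormedAddCommGroup V] [NormedSpace ℝ V] (F : V → ℝ)
    (hFc : Continuous F) (T C : Set V) (hCT : C ⊆ T) (hC : IsCompact C) (hconv : Convex ℝ C)
    (N : V → ℝ) (hF : ∀ a ∈ T, ∀ b ∈ T, F ((1 / 2 : ℝ) • (a + b)) ≤ (F a + F b) / 2 - N (a - b) ^ 2)
    (x : V) (hx : x ∈ C) : 2 * N (x - amin F C) ^ 2 ≤ F x - F (amin F C) := by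
  obtain ⟨h1, h2⟩ := amin_spec F hFc C hC ⟨x, hx⟩
  have h3 := hF x (hCT hx) _ (hCT h1)
  have h4 := h2 ((1 / 2 : ℝ) • (x + amin F C)) (by
    rw [smul_add]
    exact hconv hx h1 (by norm_num) (by norm_num) (by norm_num))
  linarith

section game
variable {V α : Type} [NormedAddCommGroup V] [NormedSpace ℝ V] (F : V → ℝ) (T : Set V)
  (lf : α → V → V → ℝ) (γ : α → ℝ)

lemma gst_props (hTc : IsCompact T) (hTconv : Convex ℝ T)
    (hlin : ∀ m y, IsLinearMap ℝ (lf m y)) (hcont : ∀ m y, Continuous (lf m y)) (l : List α) :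
    IsCompact (gst F T lf γ l) ∧ Convex ℝ (gst F T lf γ l) ∧ gst F T lf γ l ⊆ T := by
  induction l with
  | nil => exact ⟨hTc, hTconv, subset_rfl⟩
  | cons m l ih =>
    obtain ⟨h1, h2, h3⟩ := ih
    refine ⟨?_, ?_, fun v hv => h3 hv.1⟩
    · refine h1.inter_right ?_
      apply isClosed_le continuous_const
      exact (hcont m _).comp (continuous_id.sub continuous_const)
    · refine h2.inter ?_
      set y := amin F (gst F T lf γ l)
      have : {v | γ m ≤ lf m y (v - y)} = {v | γ m + lf m y y ≤ lf m y v} := by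
        ext v; simp only [Set.mem_ofPred_eq]
        rw [(hlin m y).map_sub]
        constructor <;> intro h <;> linarith
      rw [this]
      exact convex_halfSpace_ge (hlin m y) _

lemma gst_drop (l : List α) (k : ℕ) : gst F T lf γ l ⊆ gst F T lf γ (l.drop k) := by
  induction l generalizing k with
  | nil => simp
  | cons m l ih =>
    cases k with
    | zero => simp
    | succ k =>
      intro v hv
      simpa using ih k hv.1

/-- existence of a good path in the game -/
theorem game_path [Fintype α] [Nonempty α] (hTc : IsCompact T) (hTconv : Convex ℝ T)
    (hFc : Continuous F) (R : ℝ) (hF0 : ∀ x ∈ T, 0 ≤ F x) (hFR : ∀ x ∈ T, F x ≤ R)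
    (N : V → ℝ) (hF : ∀ a ∈ T, ∀ b ∈ T, F ((1 / 2 : ℝ) • (a + b)) ≤ (F a + F b) / 2 - N (a - b) ^ 2)
    (hlin : ∀ m y, IsLinearMap ℝ (lf m y)) (hcont : ∀ m y, Continuous (lf m y))
    (cost w : α → ℝ) (hcost : ∀ m, 1 ≤ cost m) (hw : ∀ m, 0 ≤ w m)
    (gap : V → V → ℝ) (I : ℕ)
    (hsucc : ∀ x ∈ T, ∀ y ∈ T, (1 / 2 : ℝ) ^ I < gap x y → ∃ (A : Finset α) (c : ℝ),
      (∀ m ∈ A, cost m = c) ∧ Real.exp (-c) ≤ ∑ m ∈ A, w m ∧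
      ∀ m ∈ A, γ m ≤ lf m y (x - y) ∧
        ∀ h, γ m ≤ lf m y h → c * gap x y ^ 2 / 8 ≤ 2 * N h ^ 2)
    (b : List α → ℝ) (hb : ∀ l, 0 ≤ b l) (Tm : ℕ) (hTm : R < Tm * ((1 / 4) ^ I / 8))
    (hpot : pot w b Tm [] ≤ 1) (x : V) (hx : x ∈ T) :
    ∃ (T0 : ℕ) (Ls : ℕ → List α), Ls 0 = [] ∧
      (∀ t, t < T0 → ∃ m, Ls (t + 1) = m :: Ls t ∧
        cost m * gap x (amin F (gst F T lf γ (Ls t))) ^ 2 / 8 ≤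
          F (amin F (gst F T lf γ (Ls (t + 1)))) - F (amin F (gst F T lf γ (Ls t)))) ∧
      (∀ t, t ≤ T0 → x ∈ gst F T lf γ (Ls t) ∧ b (Ls t) ≤ Real.exp (tcost cost (Ls t))) ∧
      (∀ t, t < T0 → (1 / 2) ^ I < gap x (amin F (gst F T lf γ (Ls t)))) ∧
      gap x (amin F (gst F T lf γ (Ls T0))) ≤ (1 / 2) ^ I := by
  classical
  set Y : List α → V := fun l => amin F (gst F T lf γ l) with hY
  set G := gst F T lf γ with hG
  have hp := gst_props F T lf γ hTc hTconv hlin hcont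
  set P : List α → Prop := fun l => x ∈ G l ∧ l.length ≤ Tm ∧
    pot w b (Tm - l.length) l ≤ Real.exp (tcost cost l) ∧
    (l.length : ℝ) * ((1 / 4) ^ I / 8) ≤ F (Y l) with hP
  have hYT : ∀ l, x ∈ G l → Y l ∈ G l := fun l hl =>
    (amin_spec F hFc _ (hp l).1 ⟨x, hl⟩).1
  have hP0 : P [] := by
    refine ⟨hx, by simp, ?_, ?_⟩
    · simpa [tcost] using hpot
    · simpa using hF0 _ ((hp []).2.2 (hYT [] hx))
  have hstep : ∀ l, P l → (1 / 2 : ℝ) ^ I < gap x (Y l) → ∃ m, P (m :: l) ∧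
      cost m * gap x (Y l) ^ 2 / 8 ≤ F (Y (m :: l)) - F (Y l) := by
    intro l ⟨p1, p2, p3, p4⟩ hg
    have hyl := hYT l p1
    have hyT := (hp l).2.2 hyl
    obtain ⟨A, c, hA1, hA2, hA3⟩ := hsucc x hx (Y l) hyT hg
    have hlt : l.length < Tm := by
      by_contra hcon
      have e : l.length = Tm := by omega
      rw [e] at p4
      have := hFR _ hyT
      linarith
    have e1 : Tm - l.length = (Tm - (l.length + 1)) + 1 := by omega
    rw [e1] at p3
    obtain ⟨m, hm, hpm⟩ := pot_step w b hw hb _ l _ (Real.exp (-c)) (Real.exp_pos _) p3 A hA2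
    obtain ⟨hA31, hA32⟩ := hA3 m hm
    have hx' : x ∈ G (m :: l) := ⟨p1, hA31⟩
    have hy' := hYT _ hx'
    have hgain := amin_gain F hFc T (G l) (hp l).2.2 (hp l).1 (hp l).2.1 N hF (Y (m :: l)) hy'.1
    have h2 := hA32 (Y (m :: l) - Y l) hy'.2
    have h3 : c * gap x (Y l) ^ 2 / 8 ≤ F (Y (m :: l)) - F (Y l) := h2.trans hgain
    have hc1 : 1 ≤ c := hA1 m hm ▸ hcost m
    refine ⟨m, ⟨hx', ?_, ?_, ?_⟩, ?_⟩
    · simpa using hlt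
    · simp only [List.length_cons]
      refine hpm.trans (le_of_eq ?_)
      rw [← Real.exp_sub]
      congr 1
      simp [tcost, hA1 m hm]; ring
    · have h4 : ((1:ℝ) / 4) ^ I ≤ gap x (Y l) ^ 2 := by
        have : ((1:ℝ) / 4) ^ I = ((1 / 2) ^ I) ^ 2 := by
          rw [← pow_mul, mul_comm, pow_mul]; norm_num
        rw [this]
        exact pow_le_pow_left₀ (by positivity) hg.le 2
      have h5 : 1 * ((1:ℝ) / 4) ^ I ≤ c * gap x (Y l) ^ 2 := by gcongr
      simp only [List.length_cons]; push_cast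
      linarith
    · rw [hA1 m hm]; exact h3
  choose! f hf1 hf2 using hstep
  set nx : List α → List α := fun l => f l :: l with hnx
  set Ls : ℕ → List α := fun t => nx^[t] [] with hLs
  have Lsucc : ∀ t, Ls (t + 1) = f (Ls t) :: Ls t := by
    intro t; simp only [hLs]; rw [Function.iterate_succ_apply']
  have Llen : ∀ t, (Ls t).length = t := by
    intro t
    induction t with
    | zero => rfl
    | succ t ih => rw [Lsucc, List.length_cons, ih]
  have hPt : ∀ t, (∀ s, s < t → (1 / 2 : ℝ) ^ I < gap x (Y (Ls s))) → P (Ls t) := by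
    intro t
    induction t with
    | zero => intro _; exact hP0
    | succ t ih =>
      intro h
      rw [Lsucc]
      exact hf1 _ (ih fun s hs => h s (by omega)) (h t (by omega))
  have hex : ∃ t, gap x (Y (Ls t)) ≤ (1 / 2 : ℝ) ^ I := by
    by_contra hcon
    push Not at hcon
    have := (hPt (Tm + 1) fun s _ => hcon s).2.1
    rw [Llen] at this
    omega
  set T0 := Nat.find hex
  have hmin : ∀ t, t < T0 → (1 / 2 : ℝ) ^ I < gap x (Y (Ls t)) := fun t ht =>
    not_le.1 (Nat.find_min hex ht)
  have hPP : ∀ t, t ≤ T0 → P (Ls t) := fun t ht => hPt t fun s hs => hmin s (by omega)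
  refine ⟨T0, Ls, rfl, ?_, ?_, hmin, Nat.find_spec hex⟩
  · intro t ht
    refine ⟨f (Ls t), Lsucc t, ?_⟩
    rw [Lsucc]
    exact hf2 _ (hPP t ht.le) (hmin t ht)
  · intro t ht
    obtain ⟨q1, q2, q3, q4⟩ := hPP t ht
    exact ⟨q1, (le_pot w b hw hb _ _).trans q3⟩

end game

end

open MeasureTheory

noncomputable section

/-- euclidean length of the restriction to `J` -/
def ltwo {n : ℕ} (J : Finset (Fin n)) (u : Fin n → ℝ) : ℝ := Real.sqrt (∑ j ∈ J, u j ^ 2)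

lemma ltwo_nonneg {n : ℕ} (J : Finset (Fin n)) (u : Fin n → ℝ) : 0 ≤ ltwo J u := Real.sqrt_nonneg _

lemma ltwo_sq {n : ℕ} (J : Finset (Fin n)) (u : Fin n → ℝ) : ltwo J u ^ 2 = ∑ j ∈ J, u j ^ 2 :=
  Real.sq_sqrt (Finset.sum_nonneg fun _ _ => sq_nonneg _)

lemma ltwo_mono {n : ℕ} (J : Finset (Fin n)) (u v : Fin n → ℝ) (h : ∀ j, |u j| ≤ v j) :
    ltwo J u ≤ ltwo J v := by
  apply Real.sqrt_le_sqrt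
  refine Finset.sum_le_sum fun j _ => ?_
  rw [← sq_abs (u j)]
  exact pow_le_pow_left₀ (abs_nonneg _) (h j) 2

lemma ltwo_add {n : ℕ} (J : Finset (Fin n)) (u v : Fin n → ℝ) :
    ltwo J (fun j => u j + v j) ≤ ltwo J u + ltwo J v := by
  apply Real.sqrt_le_iff.2 ⟨add_nonneg (ltwo_nonneg _ _) (ltwo_nonneg _ _), ?_⟩
  have h := Real.sum_mul_le_sqrt_mul_sqrt J u v
  have e : ∑ j ∈ J, (u j + v j) ^ 2 = ∑ j ∈ J, u j ^ 2 + ∑ j ∈ J, v j ^ 2 + 2 * ∑ j ∈ J, u j * v j := by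
    rw [Finset.mul_sum, ← Finset.sum_add_distrib, ← Finset.sum_add_distrib]
    exact Finset.sum_congr rfl fun j _ => by ring
  rw [e, add_sq, ltwo_sq, ltwo_sq]
  have : ltwo J u * ltwo J v = Real.sqrt (∑ j ∈ J, u j ^ 2) * Real.sqrt (∑ j ∈ J, v j ^ 2) := rfl
  linarith

lemma ltwo_smul {n : ℕ} (J : Finset (Fin n)) (c : ℝ) (hc : 0 ≤ c) (u : Fin n → ℝ) :
    ltwo J (fun j => c * u j) = c * ltwo J u := by
  unfold ltwo
  simp_rw [mul_pow]
  rw [← Finset.mul_sum, Real.sqrt_mul (sq_nonneg c), Real.sqrt_sq hc]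

lemma sum_le_ltwo {n : ℕ} (J : Finset (Fin n)) (u : Fin n → ℝ) :
    ∑ j ∈ J, |u j| ≤ Real.sqrt n * ltwo J u := by
  have h := Real.sum_mul_le_sqrt_mul_sqrt J (fun _ => (1:ℝ)) (fun j => |u j|)
  simp only [one_mul, one_pow, sq_abs] at h
  refine h.trans ?_
  apply mul_le_mul_of_nonneg_right _ (Real.sqrt_nonneg _)
  apply Real.sqrt_le_sqrt
  have := Finset.card_le_univ J
  simp only [Finset.sum_const, nsmul_eq_mul, mul_one, Fintype.card_fin] at *
  exact_mod_cast this

/-- the moves of the game -/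
abbrev Mv (n I : ℕ) : Type := Fin I × ((Fin n × Fin 4) ⊕ (Fin n → Bool))

/-- the four phases -/
def phs : Fin 4 → ℂ := ![1, -1, -Complex.I, Complex.I]

lemma phs_norm (p : Fin 4) : ‖phs p‖ = 1 := by
  fin_cases p <;> simp [phs]

lemma phs_exists (z : ℂ) : ∃ p, ‖z‖ / 2 ≤ (phs p * z).re := by
  by_contra hcon
  push Not at hcon
  have h0 := hcon 0
  have h1 := hcon 1
  have h2 := hcon 2
  have h3 := hcon 3
  simp [phs] at h0 h1 h2 h3
  have h4 : ‖z‖ ^ 2 = z.re ^ 2 + z.im ^ 2 := by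
    rw [← Complex.normSq_eq_norm_sq, Complex.normSq_apply]; ring
  nlinarith [norm_nonneg z]

/-- linear functionals of the moves -/
def mlf {n I : ℕ} (J : Finset (Fin n)) (m : Mv n I) (y h : Fin n → ℂ) : ℝ :=
  match m.2 with
  | Sum.inl p => (phs p.2 * h p.1).re
  | Sum.inr g => ∑ j ∈ J, sg (g j) * ((starRingEnd ℂ) (y j) * h j).re

lemma mlf_lin {n I : ℕ} (J : Finset (Fin n)) (m : Mv n I) (y : Fin n → ℂ) :
    IsLinearMap ℝ (mlf J m y) := by
  rcases m with ⟨i, ⟨j, p⟩ | g⟩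
  · constructor
    · intro a b; simp [mlf, mul_add]
    · intro c a; simp [mlf]; ring
  · constructor
    · intro a b
      simp only [mlf, Pi.add_apply, mul_add, Complex.add_re, Finset.sum_add_distrib]
    · intro c a
      simp only [mlf, smul_eq_mul, Finset.mul_sum]
      refine Finset.sum_congr rfl fun j _ => ?_
      simp; ring

lemma mlf_cont {n I : ℕ} (J : Finset (Fin n)) (m : Mv n I) (y : Fin n → ℂ) :
    Continuous (mlf J m y) := by
  rcases m with ⟨i, ⟨j, p⟩ | g⟩
  · show Continuous fun h : Fin n → ℂ => (phs p * h j).re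
    fun_prop
  · show Continuous fun h : Fin n → ℂ => ∑ j ∈ J, sg (g j) * ((starRingEnd ℂ) (y j) * h j).re
    fun_prop

/-- the seminorm attached to the point `y` -/
def ynrm {n : ℕ} (J : Finset (Fin n)) (y h : Fin n → ℂ) : ℝ :=
  ltwo J (fun j => ((starRingEnd ℂ) (y j) * h j).re)

/-- costs of the two kinds of moves -/
def qq (n I : ℕ) : ℝ := Real.log (100 * n * I)
def el (I : ℕ) : ℝ := Real.log (1200 * I)

def mcost {n I : ℕ} (m : Mv n I) : ℝ :=
  match m.2 with
  | Sum.inl _ => qq n I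
  | Sum.inr _ => el I

def mw {n I : ℕ} (m : Mv n I) : ℝ :=
  match m.2 with
  | Sum.inl _ => 1 / (8 * n * I)
  | Sum.inr _ => 1 / (2 * I * 2 ^ n)

def mγ {n I : ℕ} (L S : ℝ) (m : Mv n I) : ℝ :=
  match m.2 with
  | Sum.inl _ => (1 / 2) ^ (m.1 : ℕ) / 4 * (L * Real.sqrt (qq n I))
  | Sum.inr _ => (1 / 2) ^ (m.1 : ℕ) / 4 * (S * Real.sqrt (el I))

def mgap {n : ℕ} (I : ℕ) (J : Finset (Fin n)) (L S : ℝ) (x y : Fin n → ℂ) : ℝ :=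
  max (ynrm J y (x - y) / (S * Real.sqrt (el I))) (‖x - y‖ / (L * Real.sqrt (qq n I)))

lemma mw_sum {n I : ℕ} (hn : 1 ≤ n) (hI : 1 ≤ I) : ∑ m : Mv n I, mw m = 1 := by
  rw [Fintype.sum_prod_type]
  simp only [Fintype.sum_sum_type, mw, Finset.sum_const, Finset.card_univ, Fintype.card_prod,
    Fintype.card_fin, Fintype.card_fun, Fintype.card_bool, nsmul_eq_mul]
  have h1 : (n:ℝ) ≠ 0 := by positivity
  have h2 : (I:ℝ) ≠ 0 := by positivity
  push_cast
  field_simp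
  norm_num

lemma exp_four_lt : Real.exp 4 < 100 := by
  have h := Real.exp_one_lt_d9
  have : Real.exp 4 = Real.exp 1 ^ 4 := by rw [← Real.exp_nat_mul]; norm_num
  rw [this]
  calc Real.exp 1 ^ 4 < 2.7182818286 ^ 4 := by gcongr
    _ < 100 := by norm_num

lemma qq_ge {n I : ℕ} (hn : 1 ≤ n) (hI : 1 ≤ I) : 4 ≤ qq n I := by
  unfold qq
  have h1 : (1:ℝ) ≤ n := by exact_mod_cast hn
  have h2 : (1:ℝ) ≤ I := by exact_mod_cast hI
  rw [Real.le_log_iff_exp_le (by positivity)]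
  have : (1:ℝ) ≤ n * I := by nlinarith
  have := exp_four_lt
  linarith

lemma el_ge {I : ℕ} (hI : 1 ≤ I) : 4 ≤ el I := by
  unfold el
  have h2 : (1:ℝ) ≤ I := by exact_mod_cast hI
  rw [Real.le_log_iff_exp_le (by positivity)]
  have := exp_four_lt
  linarith

lemma gap_le_one {n I : ℕ} (hn : 1 ≤ n) (hI : 1 ≤ I) (J : Finset (Fin n)) (T : Set (Fin n → ℂ))
    (L U S : ℝ) (hL : 0 < L) (hU : 0 < U) (hS : 2 * L * U ≤ S)
    (hTL : ∀ x ∈ T, ∀ j, ‖x j‖ ≤ L) (hTU : ∀ x ∈ T, ltwo J (fun j => ‖x j‖) ≤ U)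
    (x y : Fin n → ℂ) (hx : x ∈ T) (hy : y ∈ T) : mgap I J L S x y ≤ 1 := by
  have hq := qq_ge hn hI
  have hl := el_ge hI
  have hq1 : 2 ≤ Real.sqrt (qq n I) := Real.le_sqrt_of_sq_le (by linarith)
  have hl1 : 2 ≤ Real.sqrt (el I) := Real.le_sqrt_of_sq_le (by linarith)
  have hS0 : 0 < S := lt_of_lt_of_le (by positivity) hS
  have hxy : ∀ j, ‖(x - y) j‖ ≤ 2 * L := by
    intro j
    have := norm_sub_le (x j) (y j)
    have := hTL x hx j
    have := hTL y hy j
    simp only [Pi.sub_apply]; linarith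
  apply max_le
  · rw [div_le_one (by positivity)]
    have h1 : ynrm J y (x - y) ≤ ltwo J (fun j => (2 * L) * ‖y j‖) := by
      apply ltwo_mono
      intro j
      refine (Complex.abs_re_le_norm _).trans ?_
      rw [norm_mul, RCLike.norm_conj, mul_comm]
      exact mul_le_mul_of_nonneg_right (hxy j) (norm_nonneg _)
    rw [ltwo_smul J _ (by positivity)] at h1
    have h2 := hTU y hy
    calc _ ≤ _ := h1
      _ ≤ 2 * L * U := by gcongr
      _ ≤ S * 1 := by linarith
      _ ≤ _ := by gcongr; linarith
  · rw [div_le_one (by positivity)]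
    refine (pi_norm_le_iff_of_nonneg (by positivity)).2 fun j => ?_
    refine (hxy j).trans ?_
    nlinarith

lemma level_exists (I : ℕ) (g : ℝ) (h1 : (1 / 2 : ℝ) ^ I < g) (h2 : g ≤ 1) :
    ∃ i : Fin I, (1 / 2 : ℝ) ^ (i : ℕ) / 2 < g ∧ g ≤ (1 / 2) ^ (i : ℕ) := by
  classical
  have hex : ∃ i, (1 / 2 : ℝ) ^ i < g := ⟨I, h1⟩
  have hs := Nat.find_spec hex
  have hle := Nat.find_min' hex h1
  obtain ⟨k, hk⟩ : ∃ k, Nat.find hex = k + 1 := by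
    refine Nat.exists_eq_succ_of_ne_zero fun h => ?_
    rw [h] at hs; simp at hs; linarith
  have hm := Nat.find_min hex (m := k) (by omega)
  refine ⟨⟨k, by omega⟩, ?_, not_lt.1 hm⟩
  rw [hk, pow_succ] at hs
  simp only; linarith

lemma gain_aux (i : ℕ) (g c u : ℝ) (hg0 : 0 ≤ g) (hc : 0 ≤ c) (hg : g ≤ (1 / 2) ^ i)
    (hu : (1 / 2) ^ i / 4 * Real.sqrt c ≤ u) : c * g ^ 2 / 8 ≤ 2 * u ^ 2 := by
  have h1 : ((1 / 2) ^ i / 4 * Real.sqrt c) ^ 2 ≤ u ^ 2 := pow_le_pow_left₀ (by positivity) hu 2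
  rw [mul_pow, Real.sq_sqrt hc, div_pow] at h1
  have h2 : g ^ 2 ≤ ((1 / 2) ^ i) ^ 2 := pow_le_pow_left₀ hg0 hg 2
  nlinarith

lemma succ_lemma {n I : ℕ} (hn : 1 ≤ n) (hI : 1 ≤ I) (J : Finset (Fin n)) (T : Set (Fin n → ℂ))
    (L U S : ℝ) (hL : 0 < L) (hU : 0 < U) (hS : 2 * L * U ≤ S)
    (hTL : ∀ x ∈ T, ∀ j, ‖x j‖ ≤ L) (hTU : ∀ x ∈ T, ltwo J (fun j => ‖x j‖) ≤ U)
    (N : (Fin n → ℂ) → ℝ)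
    (hNL : ∀ h j, ‖h j‖ ≤ L * N h)
    (hBad : ∀ z ∈ T, ∃ B : Finset (Fin n → Bool), 600 * (B.card : ℝ) ≤ 2 ^ n ∧
      ∀ g, g ∉ B → ∀ h : Fin n → ℂ, ∑ j ∈ J, sg (g j) * ((starRingEnd ℂ) (z j) * h j).re ≤ S * N h)
    (x : Fin n → ℂ) (hx : x ∈ T) (y : Fin n → ℂ) (hy : y ∈ T)
    (hgap : (1 / 2 : ℝ) ^ I < mgap I J L S x y) :
    ∃ (A : Finset (Mv n I)) (c : ℝ),
      (∀ m ∈ A, mcost m = c) ∧ Real.exp (-c) ≤ ∑ m ∈ A, mw m ∧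
      ∀ m ∈ A, mγ L S m ≤ mlf J m y (x - y) ∧
        ∀ h, mγ L S m ≤ mlf J m y h → c * mgap I J L S x y ^ 2 / 8 ≤ 2 * N h ^ 2 := by
  classical
  have hq := qq_ge hn hI
  have hl := el_ge hI
  have hq1 : 2 ≤ Real.sqrt (qq n I) := Real.le_sqrt_of_sq_le (by linarith)
  have hl1 : 2 ≤ Real.sqrt (el I) := Real.le_sqrt_of_sq_le (by linarith)
  have hS0 : 0 < S := lt_of_lt_of_le (by positivity) hS
  have hn' : (1:ℝ) ≤ n := by exact_mod_cast hn
  have hI' : (1:ℝ) ≤ I := by exact_mod_cast hI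
  obtain ⟨i, hi1, hi2⟩ := level_exists I _ hgap
    (gap_le_one hn hI J T L U S hL hU hS hTL hTU x y hx hy)
  have hg0 : 0 ≤ mgap I J L S x y := le_trans (by positivity) hgap.le
  set G := mgap I J L S x y with hG
  rcases le_total (ynrm J y (x - y) / (S * Real.sqrt (el I))) (‖x - y‖ / (L * Real.sqrt (qq n I)))
    with hc | hc
  · have e : G = ‖x - y‖ / (L * Real.sqrt (qq n I)) := max_eq_right hc
    have e1 : ‖x - y‖ = G * (L * Real.sqrt (qq n I)) := by
      rw [e]; field_simp
    have : Nonempty (Fin n) := ⟨⟨0, hn⟩⟩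
    obtain ⟨j, hj⟩ : ∃ j, ‖x - y‖ ≤ ‖(x - y) j‖ := by
      obtain ⟨j, hj⟩ := Finite.exists_max (fun j => ‖(x - y) j‖)
      exact ⟨j, (pi_norm_le_iff_of_nonneg (norm_nonneg _)).2 hj⟩
    obtain ⟨p, hp⟩ := phs_exists ((x - y) j)
    refine ⟨{(i, Sum.inl (j, p))}, qq n I, ?_, ?_, ?_⟩
    · intro m hm; rw [Finset.mem_singleton] at hm; subst hm; rfl
    · rw [Finset.sum_singleton]
      simp only [mw, qq]
      rw [Real.exp_neg, Real.exp_log (by positivity), ← one_div]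
      apply one_div_le_one_div_of_le (by positivity)
      have : 0 ≤ (n:ℝ) * I := by positivity
      linarith
    · intro m hm; rw [Finset.mem_singleton] at hm; subst hm
      simp only [mγ, mlf]
      constructor
      · refine le_trans ?_ hp
        have : (1 / 2 : ℝ) ^ (i:ℕ) / 2 * (L * Real.sqrt (qq n I)) ≤ G * (L * Real.sqrt (qq n I)) := by
          gcongr
        linarith
      · intro h hh
        apply gain_aux i _ _ _ hg0 (by linarith) hi2
        have h1 : (phs p * h j).re ≤ ‖h j‖ := by
          refine (Complex.re_le_norm _).trans ?_
          rw [norm_mul, phs_norm, one_mul]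
        have h2 := hNL h j
        have h3 : L * ((1 / 2 : ℝ) ^ (i:ℕ) / 4 * Real.sqrt (qq n I)) ≤ L * N h := by linarith
        exact le_of_mul_le_mul_left h3 hL
  · have e : G = ynrm J y (x - y) / (S * Real.sqrt (el I)) := max_eq_left hc
    have e1 : ynrm J y (x - y) = G * (S * Real.sqrt (el I)) := by
      rw [e]; field_simp
    obtain ⟨B, hB1, hB2⟩ := hBad y hy
    set cc : Fin n → ℝ := fun j => if j ∈ J then ((starRingEnd ℂ) (y j) * (x - y) j).re else 0 with hcc
    have hsum : ∀ g : Fin n → Bool, ∑ j, sg (g j) * cc j =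
        ∑ j ∈ J, sg (g j) * ((starRingEnd ℂ) (y j) * (x - y) j).re := by
      intro g
      simp only [hcc, mul_ite, mul_zero]
      rw [Finset.sum_ite_mem, Finset.univ_inter]
    have hsq : ∑ j, cc j ^ 2 = ynrm J y (x - y) ^ 2 := by
      unfold ynrm
      rw [ltwo_sq]
      simp only [hcc, ite_pow]
      simp only [ne_eq, OfNat.ofNat_ne_zero, not_false_eq_true, zero_pow]
      rw [Finset.sum_ite_mem, Finset.univ_inter]
    set ρ := (1 / 2 : ℝ) ^ (i:ℕ) / 2 * (S * Real.sqrt (el I)) with hρ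
    have hρ1 : ρ ≤ ynrm J y (x - y) := by
      rw [e1, hρ]; gcongr
    have hρ0 : 0 ≤ ρ := by positivity
    have hpz := rad_pz cc ρ hρ0 (by rw [hsq]; exact pow_le_pow_left₀ hρ0 hρ1 2)
    set E := (Finset.univ.filter fun g : Fin n → Bool => ρ / 2 ≤ ∑ j, sg (g j) * cc j) with hE
    set A0 := E \ B with hA0
    have hcard : (E.card : ℝ) ≤ A0.card + B.card := by
      have : E.card ≤ A0.card + B.card := by
        have h : E.card - B.card ≤ A0.card := Finset.le_card_sdiff B E
        omega
      exact_mod_cast this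
    refine ⟨A0.image fun g => (i, Sum.inr g), el I, ?_, ?_, ?_⟩
    · intro m hm
      obtain ⟨g, hg, rfl⟩ := Finset.mem_image.1 hm
      rfl
    · rw [Finset.sum_image (by intro a _ b _ h; simpa using h)]
      simp only [mw, Finset.sum_const, nsmul_eq_mul, el]
      rw [Real.exp_neg, Real.exp_log (by positivity), ← one_div, mul_one_div, div_le_div_iff₀
        (by positivity) (by positivity)]
      have : (2:ℝ) ^ n ≤ 600 * A0.card := by linarith
      nlinarith
    · intro m hm
      obtain ⟨g, hg, rfl⟩ := Finset.mem_image.1 hm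
      obtain ⟨hg1, hg2⟩ := Finset.mem_sdiff.1 hg
      simp only [mγ, mlf]
      constructor
      · rw [← hsum]
        have := (Finset.mem_filter.1 hg1).2
        rw [hρ] at this
        linarith
      · intro h hh
        apply gain_aux i _ _ _ hg0 (by linarith) hi2
        have h2 := hB2 g hg2 h
        have h3 : S * ((1 / 2 : ℝ) ^ (i:ℕ) / 4 * Real.sqrt (el I)) ≤ S * N h := by linarith
        exact le_of_mul_le_mul_left h3 hS0

end

open MeasureTheory

noncomputable section

/-- the signed process -/
def Xp {n : ℕ} (J : Finset (Fin n)) (e : Fin n → Bool) (y : Fin n → ℂ) : ℝ :=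
  ∑ j ∈ J, sg (e j) * ‖y j‖ ^ 2

def dd {n : ℕ} (J : Finset (Fin n)) (y y' : Fin n → ℂ) : ℝ :=
  ltwo J (fun j => ‖y j‖ ^ 2 - ‖y' j‖ ^ 2)

/-- penalty of one pair -/
def pen {n : ℕ} (J : Finset (Fin n)) (e : Fin n → Bool) (y y' : Fin n → ℂ) (lam : ℝ) : ℝ :=
  Real.exp (lam * ((Xp J e y - Xp J e y') / dd J y y') - lam ^ 2) +
  Real.exp (-(lam * ((Xp J e y - Xp J e y') / dd J y y')) - lam ^ 2)

lemma Xp_sub {n : ℕ} (J : Finset (Fin n)) (e : Fin n → Bool) (y y' : Fin n → ℂ) :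
    Xp J e y - Xp J e y' = ∑ j ∈ J, sg (e j) * (‖y j‖ ^ 2 - ‖y' j‖ ^ 2) := by
  unfold Xp
  rw [← Finset.sum_sub_distrib]
  exact Finset.sum_congr rfl fun j _ => by ring

lemma pen_half {n : ℕ} (J : Finset (Fin n)) (y y' : Fin n → ℂ) (lam : ℝ) :
    ∑ e : Fin n → Bool, Real.exp (lam * ((Xp J e y - Xp J e y') / dd J y y') - lam ^ 2) ≤
      2 ^ n * Real.exp (-(lam ^ 2 / 2)) := by
  classical
  set d := dd J y y' with hd
  set c : Fin n → ℝ := fun j => if j ∈ J then lam * (‖y j‖ ^ 2 - ‖y' j‖ ^ 2) / d else 0 with hc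
  have e1 : ∀ e : Fin n → Bool, lam * ((Xp J e y - Xp J e y') / d) = ∑ j, sg (e j) * c j := by
    intro e
    simp only [hc, mul_ite, mul_zero]
    rw [Finset.sum_ite_mem, Finset.univ_inter, Xp_sub, Finset.sum_div, Finset.mul_sum]
    exact Finset.sum_congr rfl fun j _ => by ring
  have e2 : ∑ j, c j ^ 2 ≤ lam ^ 2 := by
    have : ∑ j, c j ^ 2 = lam ^ 2 * d ^ 2 / d ^ 2 := by
      simp only [hc, ite_pow]
      simp only [ne_eq, OfNat.ofNat_ne_zero, not_false_eq_true, zero_pow]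
      rw [Finset.sum_ite_mem, Finset.univ_inter]
      have hd2 : d ^ 2 = ∑ j ∈ J, (‖y j‖ ^ 2 - ‖y' j‖ ^ 2) ^ 2 := ltwo_sq _ _
      conv_rhs => rw [mul_div_assoc, hd2, Finset.sum_div, ← hd2]
      rw [Finset.mul_sum]
      exact Finset.sum_congr rfl fun j _ => by rw [div_pow, mul_pow, mul_div_assoc]
    rw [this]
    by_cases h0 : d = 0
    · rw [h0]; simp; positivity
    · rw [mul_div_assoc, div_self (by positivity), mul_one]
  have h := rad_mgf c
  simp_rw [e1, Real.exp_sub]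
  rw [← Finset.sum_div, div_le_iff₀ (Real.exp_pos _), mul_assoc, ← Real.exp_add]
  refine h.trans ?_
  gcongr
  linarith

lemma pen_sum {n : ℕ} (J : Finset (Fin n)) (y y' : Fin n → ℂ) (lam : ℝ) :
    ∑ e : Fin n → Bool, pen J e y y' lam ≤ 2 ^ n * (2 * Real.exp (-(lam ^ 2 / 2))) := by
  unfold pen
  rw [Finset.sum_add_distrib]
  have h1 := pen_half J y y' lam
  have h2 := pen_half J y y' (-lam)
  simp only [neg_mul, even_two, Even.neg_pow] at h2
  linarith

lemma pen_use {n : ℕ} (J : Finset (Fin n)) (e : Fin n → Bool) (y y' : Fin n → ℂ) (τ : ℝ)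
    (hτ : 0 < τ) (h : pen J e y y' (2 * Real.sqrt τ) ≤ Real.exp τ) :
    |Xp J e y - Xp J e y'| ≤ 5 / 2 * Real.sqrt τ * dd J y y' := by
  have hd0 : 0 ≤ dd J y y' := ltwo_nonneg _ _
  have hs : 0 < Real.sqrt τ := Real.sqrt_pos.2 hτ
  have hs2 : Real.sqrt τ ^ 2 = τ := Real.sq_sqrt hτ.le
  rcases hd0.eq_or_lt with h0 | hpos
  · have : Xp J e y - Xp J e y' = 0 := by
      rw [Xp_sub]
      apply Finset.sum_eq_zero
      intro j hj
      have h1 : ∑ j ∈ J, (‖y j‖ ^ 2 - ‖y' j‖ ^ 2) ^ 2 = 0 := by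
        rw [← ltwo_sq]; unfold dd at h0; rw [← h0]; simp
      have := (Finset.sum_eq_zero_iff_of_nonneg (fun _ _ => sq_nonneg _)).1 h1 j hj
      rw [pow_eq_zero_iff two_ne_zero] at this
      rw [this, mul_zero]
    rw [this, ← h0]; simp
  · unfold pen at h
    set D := (Xp J e y - Xp J e y') / dd J y y' with hD
    have h1 : 2 * Real.sqrt τ * D - (2 * Real.sqrt τ) ^ 2 ≤ τ := by
      apply Real.exp_le_exp.1
      have := Real.exp_pos (-(2 * Real.sqrt τ * D) - (2 * Real.sqrt τ) ^ 2)
      linarith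
    have h2 : -(2 * Real.sqrt τ * D) - (2 * Real.sqrt τ) ^ 2 ≤ τ := by
      apply Real.exp_le_exp.1
      have := Real.exp_pos ((2 * Real.sqrt τ * D) - (2 * Real.sqrt τ) ^ 2)
      linarith
    have h3 : |D| ≤ 5 / 2 * Real.sqrt τ := by
      rw [abs_le]
      constructor
      · nlinarith
      · nlinarith
    have h4 : Xp J e y - Xp J e y' = D * dd J y y' := by rw [hD]; field_simp
    rw [h4, abs_mul, abs_of_pos hpos]
    gcongr

lemma sq_diff_aux (a x : ℂ) : ‖x‖ ^ 2 - ‖a‖ ^ 2 =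
    2 * ((starRingEnd ℂ) a * (x - a)).re + ‖x - a‖ ^ 2 := by
  simp only [← Complex.normSq_eq_norm_sq, Complex.normSq_apply, Complex.mul_re, Complex.sub_re,
    Complex.sub_im, Complex.conj_re, Complex.conj_im]
  ring

lemma dd_le {n : ℕ} (J : Finset (Fin n)) (x y y' : Fin n → ℂ) :
    dd J y y' ≤ 2 * ynrm J y (x - y) + 2 * ynrm J y' (x - y') +
      (‖x - y‖ + ‖x - y'‖) * ltwo J (fun j => ‖(y - y') j‖) := by
  have h : dd J y y' ≤ ltwo J (fun j => (2 * |((starRingEnd ℂ) (y j) * (x - y) j).re| +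
      2 * |((starRingEnd ℂ) (y' j) * (x - y') j).re|) + (‖x - y‖ + ‖x - y'‖) * ‖(y - y') j‖) := by
    apply ltwo_mono
    intro j
    have h1 := sq_diff_aux (y j) (x j)
    have h2 := sq_diff_aux (y' j) (x j)
    have e : ‖y j‖ ^ 2 - ‖y' j‖ ^ 2 = (2 * ((starRingEnd ℂ) (y' j) * (x j - y' j)).re -
      2 * ((starRingEnd ℂ) (y j) * (x j - y j)).re) +
      (‖x j - y' j‖ - ‖x j - y j‖) * (‖x j - y' j‖ + ‖x j - y j‖) := by linarith
    simp only [Pi.sub_apply]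
    rw [e]
    refine (abs_add_le _ _).trans ?_
    refine add_le_add ?_ ?_
    · refine (abs_sub _ _).trans ?_
      rw [abs_mul, abs_mul]; norm_num; linarith
    · rw [abs_mul, mul_comm]
      have hA : |‖x j - y' j‖ + ‖x j - y j‖| ≤ ‖x - y‖ + ‖x - y'‖ := by
        rw [abs_of_nonneg (by positivity)]
        have := norm_le_pi_norm (x - y) j
        have := norm_le_pi_norm (x - y') j
        simp only [Pi.sub_apply] at *
        linarith
      have hB : |‖x j - y' j‖ - ‖x j - y j‖| ≤ ‖y j - y' j‖ := by
        refine (abs_norm_sub_norm_le _ _).trans (le_of_eq ?_)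
        congr 1; ring
      gcongr
  refine h.trans ?_
  refine (ltwo_add _ _ _).trans ?_
  rw [ltwo_smul _ _ (by positivity)]
  gcongr
  refine (ltwo_add _ _ _).trans ?_
  rw [ltwo_smul _ _ (by positivity), ltwo_smul _ _ (by positivity)]
  have : ∀ u : Fin n → ℝ, ltwo J (fun j => |u j|) = ltwo J u := by
    intro u; simp [ltwo, sq_abs]
  rw [this, this]
  rfl

lemma dd_x_le {n : ℕ} (J : Finset (Fin n)) (x y : Fin n → ℂ) :
    dd J x y ≤ 2 * ynrm J y (x - y) + ‖x - y‖ * ltwo J (fun j => ‖(x - y) j‖) := by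
  have h := dd_le J x x y
  have h0 : ynrm J x (x - x) = 0 := by simp [ynrm, ltwo]
  rw [h0] at h
  simp only [sub_self, norm_zero, zero_add, mul_zero] at h
  exact h

lemma beta_sum (T : ℕ) : ∑ t ∈ Finset.range (T + 1), (t : ℝ) * (2 * Real.exp (-(2 * t))) ≤
    1 - (1 / 2) ^ T := by
  induction T with
  | zero => simp
  | succ T ih =>
    rw [Finset.sum_range_succ]
    have h1 : Real.exp (-(2 * ((T + 1 : ℕ) : ℝ))) ≤ (1 / 4) ^ (T + 1) := by
      have : -(2 * ((T + 1 : ℕ) : ℝ)) = ((T + 1 : ℕ) : ℝ) * (-2) := by ring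
      rw [this, Real.exp_nat_mul]
      have h2 : Real.exp (-2) ≤ 1 / 4 := by
        rw [Real.exp_neg, ← one_div]
        apply one_div_le_one_div_of_le (by norm_num)
        have h3 := Real.add_one_le_exp 1
        have h4 : Real.exp 2 = Real.exp 1 * Real.exp 1 := by rw [← Real.exp_add]; norm_num
        nlinarith
      gcongr
    have h3 : 2 * ((T + 1 : ℕ) : ℝ) ≤ 2 ^ (T + 1) := by
      have : T + 1 ≤ 2 ^ T := Nat.lt_two_pow_self
      have h : ((T + 1 : ℕ) : ℝ) ≤ 2 ^ T := by exact_mod_cast this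
      rw [pow_succ]; linarith
    have h4 : ((T + 1 : ℕ) : ℝ) * (2 * Real.exp (-(2 * ((T + 1 : ℕ) : ℝ)))) ≤ (1 / 2) ^ (T + 1) := by
      calc _ = 2 * ((T + 1 : ℕ) : ℝ) * Real.exp (-(2 * ((T + 1 : ℕ) : ℝ))) := by ring
        _ ≤ 2 ^ (T + 1) * (1 / 4) ^ (T + 1) := by gcongr
        _ = (1 / 2) ^ (T + 1) := by rw [← mul_pow]; norm_num
    rw [pow_succ] at h4 ⊢
    linarith

lemma mcost_ge {n I : ℕ} (hn : 1 ≤ n) (hI : 1 ≤ I) (m : Mv n I) : 1 ≤ mcost m := by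
  have h1 := qq_ge hn hI
  have h2 := el_ge hI
  rcases m with ⟨i, p | g⟩
  · simp only [mcost]; linarith
  · simp only [mcost]; linarith

lemma mw_nonneg {n I : ℕ} (m : Mv n I) : 0 ≤ mw m := by
  rcases m with ⟨i, p | g⟩
  · simp only [mw]; positivity
  · simp only [mw]; positivity

lemma tcost_ge {n I : ℕ} (hn : 1 ≤ n) (hI : 1 ≤ I) (l : List (Mv n I)) :
    (l.length : ℝ) ≤ tcost mcost l := by
  induction l with
  | nil => simp [tcost]
  | cons m l ih =>
    simp only [tcost, List.map_cons, List.sum_cons, List.length_cons] at *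
    have := mcost_ge hn hI m
    push_cast; linarith

/-- the total penalty of a history -/
def bpen {n I : ℕ} (J : Finset (Fin n)) (Y : List (Mv n I) → Fin n → ℂ) (e : Fin n → Bool)
    (l : List (Mv n I)) : ℝ :=
  ∑ k ∈ Finset.range l.length, pen J e (Y l) (Y (l.drop (k + 1))) (2 * Real.sqrt (tcost mcost l))

lemma pen_nonneg {n : ℕ} (J : Finset (Fin n)) (e : Fin n → Bool) (y y' : Fin n → ℂ) (lam : ℝ) :
    0 ≤ pen J e y y' lam := by unfold pen; positivity

lemma exists_sign {n I : ℕ} (hn : 1 ≤ n) (hI : 1 ≤ I) (J : Finset (Fin n))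
    (Y : List (Mv n I) → Fin n → ℂ) (Tm : ℕ) :
    ∃ e : Fin n → Bool, pot mw (bpen J Y e) Tm [] ≤ 1 := by
  by_contra hcon
  push Not at hcon
  have h1 : ∑ e : Fin n → Bool, (1:ℝ) < ∑ e : Fin n → Bool, pot mw (bpen J Y e) Tm [] :=
    Finset.sum_lt_sum_of_nonempty Finset.univ_nonempty fun e _ => hcon e
  rw [pot_sum] at h1
  have h2 : ∀ l : List (Mv n I), ∑ e : Fin n → Bool, bpen J Y e l ≤
      (fun t : ℕ => 2 ^ n * ((t:ℝ) * (2 * Real.exp (-(2 * t))))) l.length := by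
    intro l
    have ht := tcost_ge hn hI l
    have ht0 : 0 ≤ tcost mcost l := le_trans (by positivity) ht
    unfold bpen
    rw [Finset.sum_comm]
    calc _ ≤ ∑ k ∈ Finset.range l.length, 2 ^ n * (2 * Real.exp (-(2 * (l.length : ℝ)))) := by
          refine Finset.sum_le_sum fun k _ => (pen_sum J _ _ _).trans ?_
          gcongr
          rw [mul_pow, Real.sq_sqrt ht0]
          linarith
      _ = _ := by
          rw [Finset.sum_const, Finset.card_range, nsmul_eq_mul]; ring
  have h3 := pot_le mw (fun l => ∑ e : Fin n → Bool, bpen J Y e l) mw_nonneg (mw_sum hn hI)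
    (fun t : ℕ => 2 ^ n * ((t:ℝ) * (2 * Real.exp (-(2 * t))))) h2 Tm []
  simp only [List.length_nil, zero_add] at h3
  rw [← Finset.mul_sum] at h3
  have h4 := beta_sum Tm
  have h5 : (0:ℝ) ≤ (1 / 2) ^ Tm := by positivity
  have h6 : (2:ℝ) ^ n * ∑ t ∈ Finset.range (Tm + 1), (t : ℝ) * (2 * Real.exp (-(2 * t))) ≤ 2 ^ n * 1 := by
    gcongr; linarith
  simp at h1
  linarith

theorem process_bound {n I : ℕ} (hn : 1 ≤ n) (hI : 1 ≤ I) (hnI : n ≤ 2 ^ I)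
    (J : Finset (Fin n)) (T : Set (Fin n → ℂ))
    (hTc : IsCompact T) (hTconv : Convex ℝ T) (h0T : 0 ∈ T) (F : (Fin n → ℂ) → ℝ)
    (hFc : Continuous F) (R : ℝ) (hF00 : F 0 = 0) (hF0 : ∀ x ∈ T, 0 ≤ F x) (hFR : ∀ x ∈ T, F x ≤ R)
    (N : (Fin n → ℂ) → ℝ) (hN0 : ∀ h, 0 ≤ N h)
    (hF : ∀ a ∈ T, ∀ b ∈ T, F ((1 / 2 : ℝ) • (a + b)) ≤ (F a + F b) / 2 - N (a - b) ^ 2)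
    (L U S : ℝ) (hL : 0 < L) (hU : 0 < U) (hS : 2 * L * U ≤ S)
    (hTL : ∀ x ∈ T, ∀ j, ‖x j‖ ≤ L) (hTU : ∀ x ∈ T, ltwo J (fun j => ‖x j‖) ≤ U)
    (hNL : ∀ h j, ‖h j‖ ≤ L * N h)
    (hNU : ∀ h : Fin n → ℂ, ltwo J (fun j => ‖h j‖) ≤ U * N h)
    (hBad : ∀ z ∈ T, ∃ B : Finset (Fin n → Bool), 600 * (B.card : ℝ) ≤ 2 ^ n ∧
      ∀ g, g ∉ B → ∀ h : Fin n → ℂ, ∑ j ∈ J, sg (g j) * ((starRingEnd ℂ) (z j) * h j).re ≤ S * N h) :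
    ∃ e : Fin n → Bool, ∀ x ∈ T, |Xp J e x| ≤
      50 * (S * Real.sqrt (el I)) * Real.sqrt (I * R) + 18 * (U * (L * Real.sqrt (qq n I))) * R +
      2 * (S * Real.sqrt (el I)) + 2 * (U * (L * Real.sqrt (qq n I))) := by
  obtain ⟨Tm, hTm⟩ := exists_nat_gt (R / ((1 / 4) ^ I / 8))
  rw [div_lt_iff₀ (by positivity)] at hTm
  set Y : List (Mv n I) → Fin n → ℂ := fun l => amin F (gst F T (mlf J) (mγ L S) l) with hY
  obtain ⟨e, he⟩ := exists_sign hn hI J Y Tm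
  refine ⟨e, fun x hx => ?_⟩
  have : Nonempty (Mv n I) := ⟨(⟨0, hI⟩, Sum.inr fun _ => true)⟩
  obtain ⟨T0, Ls, hL0, hLs, hLb, hLg, hLT⟩ := game_path F T (mlf J) (mγ L S) hTc hTconv hFc R hF0 hFR N hF
    (mlf_lin J) (mlf_cont J) mcost mw (mcost_ge hn hI) mw_nonneg (mgap I J L S) I
    (fun x hx y hy hg => succ_lemma hn hI J T L U S hL hU hS hTL hTU N hNL hBad x hx y hy hg)
    (bpen J Y e) (fun l => Finset.sum_nonneg fun k _ => pen_nonneg _ _ _ _ _) Tm hTm he x hx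
  have hq := qq_ge hn hI
  have hl := el_ge hI
  have hq1 : 2 ≤ Real.sqrt (qq n I) := Real.le_sqrt_of_sq_le (by linarith)
  have hl1 : 2 ≤ Real.sqrt (el I) := Real.le_sqrt_of_sq_le (by linarith)
  have hS0 : 0 < S := lt_of_lt_of_le (by positivity) hS
  set a1 := S * Real.sqrt (el I) with ha1
  set a2 := L * Real.sqrt (qq n I) with ha2
  have ha1p : 0 < a1 := by positivity
  have ha2p : 0 < a2 := by positivity
  set y : ℕ → Fin n → ℂ := fun t => Y (Ls t) with hy
  set g : ℕ → ℝ := fun t => mgap I J L S x (y t) with hg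
  have hg1 : ∀ t, ynrm J (y t) (x - y t) ≤ a1 * g t := by
    intro t
    have : ynrm J (y t) (x - y t) / a1 ≤ g t := le_max_left _ _
    rw [div_le_iff₀ ha1p] at this; linarith
  have hg2 : ∀ t, ‖x - y t‖ ≤ a2 * g t := by
    intro t
    have : ‖x - y t‖ / a2 ≤ g t := le_max_right _ _
    rw [div_le_iff₀ ha2p] at this; linarith
  have hgn : ∀ t, 0 ≤ g t := by
    intro t
    have : ‖x - y t‖ / a2 ≤ g t := le_max_right _ _
    exact le_trans (by positivity) this
  have hp := gst_props (α := Mv n I) F T (mlf J) (mγ L S) hTc hTconv (mlf_lin J) (mlf_cont J)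
  have hyT : ∀ t, t ≤ T0 → y t ∈ gst F T (mlf J) (mγ L S) (Ls t) := fun t ht =>
    (amin_spec F hFc _ (hp (Ls t)).1 ⟨x, (hLb t ht).1⟩).1
  have hyTT : ∀ t, t ≤ T0 → y t ∈ T := fun t ht => (hp (Ls t)).2.2 (hyT t ht)
  have hdrop : ∀ s t, s ≤ t → t ≤ T0 → Ls s = (Ls t).drop (t - s) := by
    intro s t hst
    induction t, hst using Nat.le_induction with
    | base => intro _; simp
    | succ t hst ih =>
      intro h
      obtain ⟨m, hm, _⟩ := hLs t (by omega)
      rw [hm, show t + 1 - s = (t - s) + 1 by omega, List.drop_succ_cons]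
      exact ih (by omega)
  have hlen : ∀ t, t ≤ T0 → (Ls t).length = t := by
    intro t
    induction t with
    | zero => intro _; rw [hL0]; rfl
    | succ t ih =>
      intro h
      obtain ⟨m, hm, _⟩ := hLs t (by omega)
      rw [hm, List.length_cons, ih (by omega)]
  have hNst : ∀ s t, s ≤ t → t ≤ T0 → 2 * N (y t - y s) ^ 2 ≤ F (y t) - F (y s) := by
    intro s t hst ht
    apply amin_gain F hFc T (gst F T (mlf J) (mγ L S) (Ls s)) (hp _).2.2 (hp _).1 (hp _).2.1 N hF
    rw [hdrop s t hst ht]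
    exact gst_drop F T _ _ _ _ (hyT t ht)
  have hX : ∀ s t, s < t → t ≤ T0 → |Xp J e (y t) - Xp J e (y s)| ≤
      5 / 2 * Real.sqrt (tcost mcost (Ls t)) * ((2 * a1) * (g s + g t) +
        (U * a2) * N (y t - y s) * (g s + g t)) := by
    intro s t hst ht
    have hb := (hLb t ht).2
    have hpen : pen J e (y t) (y s) (2 * Real.sqrt (tcost mcost (Ls t))) ≤
        Real.exp (tcost mcost (Ls t)) := by
      refine le_trans ?_ hb
      have hk : t - s - 1 ∈ Finset.range (Ls t).length := by
        rw [hlen t ht, Finset.mem_range]; omega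
      have := Finset.single_le_sum (f := fun k => pen J e (Y (Ls t)) (Y ((Ls t).drop (k + 1)))
        (2 * Real.sqrt (tcost mcost (Ls t)))) (fun k _ => pen_nonneg _ _ _ _ _) hk
      rw [show t - s - 1 + 1 = t - s by omega, ← hdrop s t hst.le ht] at this
      exact this
    have hτ : 0 < tcost mcost (Ls t) := by
      refine lt_of_lt_of_le ?_ (tcost_ge hn hI _)
      rw [hlen t ht]; exact_mod_cast (by omega : 0 < t)
    refine (pen_use J e _ _ _ hτ hpen).trans ?_
    apply mul_le_mul_of_nonneg_left _ (by positivity)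
    refine (dd_le J x (y t) (y s)).trans ?_
    have h1 := hg1 t
    have h2 := hg1 s
    have h3 := hg2 t
    have h4 := hg2 s
    have h5 := hNU (y t - y s)
    have h6 : (‖x - y t‖ + ‖x - y s‖) * ltwo J (fun j => ‖(y t - y s) j‖) ≤
        (a2 * g t + a2 * g s) * (U * N (y t - y s)) := by
      have := ltwo_nonneg J (fun j => ‖(y t - y s) j‖)
      have := hgn t
      have := hgn s
      gcongr
    linarith
  have hy0 : ∀ j, y 0 j = 0 := by
    intro j
    have h1 : 2 * N (0 - y 0) ^ 2 ≤ F 0 - F (y 0) := by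
      apply amin_gain F hFc T (gst F T (mlf J) (mγ L S) (Ls 0)) (hp _).2.2 (hp _).1 (hp _).2.1 N hF
      rw [hL0]; exact h0T
    have h2 := hF0 _ (hyTT 0 (Nat.zero_le _))
    have h3 : N (0 - y 0) = 0 := by
      have : N (0 - y 0) ^ 2 ≤ 0 := by linarith
      exact pow_eq_zero_iff two_ne_zero |>.1 (le_antisymm this (sq_nonneg _))
    have h4 := hNL (0 - y 0) j
    rw [h3] at h4
    simpa using h4
  have hX0 : Xp J e (y 0) = 0 := by
    unfold Xp; exact Finset.sum_eq_zero fun j _ => by rw [hy0]; simp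
  have hmain := chain_bound I T0 (fun t => F (y t)) g (fun t => tcost mcost (Ls t))
    (fun t => Xp J e (y t)) (fun s t => N (y t - y s)) R (2 * a1) (U * a2) (by positivity)
    (by positivity) (hF0 _ (hyTT 0 (Nat.zero_le _))) (hFR _ (hyTT T0 le_rfl))
    (fun s t => hN0 _) hNst (by simp [hL0, tcost])
    (by
      intro t ht
      obtain ⟨m, hm, _⟩ := hLs t ht
      have := mcost_ge hn hI m
      simp only [hm, tcost, List.map_cons, List.sum_cons]; linarith)
    (by
      intro t ht
      obtain ⟨m, hm, hm2⟩ := hLs t ht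
      refine le_trans (le_of_eq ?_) hm2
      simp only [hm, tcost, List.map_cons, List.sum_cons, hg, hy, hY]; ring)
    hgn (gap_le_one hn hI J T L U S hL hU hS hTL hTU x _ hx (hyTT 0 (Nat.zero_le _)))
    hLT hLg hX
  simp only [hX0, sub_zero] at hmain
  -- terminal step
  have hterm : |Xp J e x - Xp J e (y T0)| ≤ 2 * a1 + 2 * (U * a2) := by
    rw [Xp_sub]
    refine (Finset.abs_sum_le_sum_abs _ _).trans ?_
    simp only [abs_mul, sg_abs, one_mul]
    refine (sum_le_ltwo J (fun j => ‖x j‖ ^ 2 - ‖y T0 j‖ ^ 2)).trans ?_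
    have h1 := dd_x_le J x (y T0)
    have h2 := hg1 T0
    have h3 := hg2 T0
    have h4 : ltwo J (fun j => ‖(x - y T0) j‖) ≤ 2 * U := by
      have h5 : ltwo J (fun j => ‖(x - y T0) j‖) ≤ ltwo J (fun j => ‖x j‖ + ‖y T0 j‖) := by
        apply ltwo_mono; intro j
        rw [abs_of_nonneg (norm_nonneg _)]
        exact norm_sub_le _ _
      have h6 := ltwo_add J (fun j => ‖x j‖) (fun j => ‖y T0 j‖)
      have h7 := hTU x hx
      have h8 := hTU _ (hyTT T0 le_rfl)
      linarith
    have h5 : dd J x (y T0) ≤ (2 * a1 + 2 * (U * a2)) * (1 / 2) ^ I := by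
      have h6 : ‖x - y T0‖ * ltwo J (fun j => ‖(x - y T0) j‖) ≤ (a2 * g T0) * (2 * U) := by
        have := ltwo_nonneg J (fun j => ‖(x - y T0) j‖)
        have := hgn T0
        gcongr
      calc _ ≤ (2 * a1 + 2 * (U * a2)) * g T0 := by linarith
        _ ≤ _ := by gcongr
    have h6 : Real.sqrt n ≤ 2 ^ I := by
      have hn1 : (1:ℝ) ≤ n := by exact_mod_cast hn
      have : Real.sqrt n ≤ n := by
        rw [Real.sqrt_le_iff]; constructor <;> nlinarith
      refine this.trans ?_
      exact_mod_cast hnI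
    calc Real.sqrt n * dd J x (y T0) ≤ 2 ^ I * ((2 * a1 + 2 * (U * a2)) * (1 / 2) ^ I) := by
          gcongr
          exact ltwo_nonneg _ _
      _ = (2 * a1 + 2 * (U * a2)) * (2 ^ I * (1 / 2) ^ I) := by ring
      _ = _ := by rw [← mul_pow]; norm_num
  have : |Xp J e x| ≤ |Xp J e x - Xp J e (y T0)| + |Xp J e (y T0)| := by
    have := abs_add_le (Xp J e x - Xp J e (y T0)) (Xp J e (y T0))
    simpa using this
  linarith

end

open MeasureTheory

noncomputable section

/-- Huber functions -/
def hub (τ t : ℝ) : ℝ := if t ≤ τ then t ^ 2 / (2 * τ) else t - τ / 2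

lemma hub_ge (τ t s : ℝ) (hτ : 0 < τ) (hs1 : s ≤ 1) :
    s * t - τ * s ^ 2 / 2 ≤ hub τ t := by
  unfold hub
  split_ifs with h
  · rw [le_div_iff₀ (by positivity)]
    nlinarith [sq_nonneg (t - τ * s)]
  · push Not at h
    nlinarith [mul_nonneg (sub_nonneg.2 hs1) (sub_nonneg.2 h.le), mul_nonneg hτ.le (sq_nonneg (1 - s))]

lemma hub_eq (τ t : ℝ) (hτ : 0 < τ) (ht : 0 ≤ t) :
    ∃ s, 0 ≤ s ∧ s ≤ 1 ∧ hub τ t = s * t - τ * s ^ 2 / 2 := by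
  unfold hub
  split_ifs with h
  · refine ⟨t / τ, by positivity, by rw [div_le_one hτ]; exact h, ?_⟩
    field_simp; ring
  · exact ⟨1, by norm_num, le_rfl, by ring⟩

lemma hub_nonneg (τ t : ℝ) (hτ : 0 < τ) : 0 ≤ hub τ t := by
  have := hub_ge τ t 0 hτ (by norm_num); simpa using this

lemma hub_le (τ t : ℝ) (hτ : 0 < τ) (ht : 0 ≤ t) : hub τ t ≤ t := by
  obtain ⟨s, h0, h1, h2⟩ := hub_eq τ t hτ ht
  rw [h2]; nlinarith [mul_nonneg hτ.le (sq_nonneg s)]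

lemma hub_lip (τ t u : ℝ) (hτ : 0 < τ) (ht : 0 ≤ t) : hub τ t ≤ hub τ u + |t - u| := by
  obtain ⟨s, h0, h1, h2⟩ := hub_eq τ t hτ ht
  have h3 := hub_ge τ u s hτ h1
  have h4 := le_abs_self (t - u)
  have h5 := abs_nonneg (t - u)
  rw [h2]
  nlinarith [mul_le_mul_of_nonneg_left h4 h0, mul_le_mul_of_nonneg_right h1 h5]

lemma hub_mid (τ : ℝ) (hτ : 0 < τ) (u v : ℂ) :
    hub τ ‖(1 / 2 : ℂ) * (u + v)‖ ≤ (hub τ ‖u‖ + hub τ ‖v‖) / 2 := by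
  obtain ⟨s, h0, h1, h2⟩ := hub_eq τ ‖(1 / 2 : ℂ) * (u + v)‖ hτ (norm_nonneg _)
  have h3 := hub_ge τ ‖u‖ s hτ h1
  have h4 := hub_ge τ ‖v‖ s hτ h1
  have h5 : ‖(1 / 2 : ℂ) * (u + v)‖ ≤ (‖u‖ + ‖v‖) / 2 := by
    rw [norm_mul]; norm_num
    have := norm_add_le u v
    linarith
  rw [h2]
  nlinarith [mul_le_mul_of_nonneg_left h5 h0]

lemma par_c (u v : ℂ) : ‖(1 / 2 : ℂ) * (u + v)‖ ^ 2 = (‖u‖ ^ 2 + ‖v‖ ^ 2) / 2 - ‖u - v‖ ^ 2 / 4 := by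
  simp only [← Complex.normSq_eq_norm_sq, Complex.normSq_apply, Complex.mul_re, Complex.mul_im,
    Complex.sub_re, Complex.sub_im, Complex.add_re, Complex.add_im]
  norm_num
  ring

lemma hub_mid_strong (τ : ℝ) (hτ : 0 < τ) (u v : ℂ) (hu : ‖u‖ ≤ τ) (hv : ‖v‖ ≤ τ) :
    hub τ ‖(1 / 2 : ℂ) * (u + v)‖ + ‖u - v‖ ^ 2 / (8 * τ) ≤ (hub τ ‖u‖ + hub τ ‖v‖) / 2 := by
  have h5 : ‖(1 / 2 : ℂ) * (u + v)‖ ≤ τ := by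
    rw [norm_mul]; norm_num
    have := norm_add_le u v
    linarith
  unfold hub
  rw [if_pos h5, if_pos hu, if_pos hv, par_c]
  apply le_of_eq
  field_simp
  ring

/-- sum of Huber functions -/
def Phi (K : ℕ) (t : ℝ) : ℝ := ∑ i ∈ Finset.range (K + 1), hub (2 ^ i) t

lemma Phi_nonneg (K : ℕ) (t : ℝ) : 0 ≤ Phi K t :=
  Finset.sum_nonneg fun i _ => hub_nonneg _ _ (by positivity)

lemma Phi_zero (K : ℕ) : Phi K 0 = 0 := by
  apply Finset.sum_eq_zero
  intro i _
  simp [hub]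

lemma Phi_le (K : ℕ) (t : ℝ) (ht : 0 ≤ t) : Phi K t ≤ (K + 1) * t := by
  unfold Phi
  calc _ ≤ ∑ i ∈ Finset.range (K + 1), t :=
        Finset.sum_le_sum fun i _ => hub_le _ _ (by positivity) ht
    _ = _ := by simp

lemma Phi_lip (K : ℕ) (t u : ℝ) (ht : 0 ≤ t) : Phi K t ≤ Phi K u + (K + 1) * |t - u| := by
  unfold Phi
  calc _ ≤ ∑ i ∈ Finset.range (K + 1), (hub (2 ^ i) u + |t - u|) :=
        Finset.sum_le_sum fun i _ => hub_lip _ _ _ (by positivity) ht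
    _ = _ := by rw [Finset.sum_add_distrib]; simp

lemma Phi_mid (K : ℕ) (u v : ℂ) :
    Phi K ‖(1 / 2 : ℂ) * (u + v)‖ ≤ (Phi K ‖u‖ + Phi K ‖v‖) / 2 := by
  unfold Phi
  rw [← Finset.sum_add_distrib, Finset.sum_div]
  exact Finset.sum_le_sum fun i _ => hub_mid _ (by positivity) u v

lemma Phi_mid_strong (K : ℕ) (u v : ℂ) (h : max ‖u‖ ‖v‖ ≤ 2 ^ K) :
    Phi K ‖(1 / 2 : ℂ) * (u + v)‖ + ‖u - v‖ ^ 2 / (16 * (1 + max ‖u‖ ‖v‖)) ≤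
      (Phi K ‖u‖ + Phi K ‖v‖) / 2 := by
  classical
  set m := max ‖u‖ ‖v‖ with hm
  have hm0 : 0 ≤ m := le_max_of_le_left (norm_nonneg _)
  have hex : ∃ i : ℕ, m ≤ 2 ^ i := ⟨K, h⟩
  set i := Nat.find hex with hi
  have hs : m ≤ 2 ^ i := Nat.find_spec hex
  have hiK : i ≤ K := Nat.find_min' hex h
  have hτ : (2:ℝ) ^ i ≤ 2 * (1 + m) := by
    rcases Nat.eq_zero_or_pos i with h0 | hp
    · rw [h0]; simp; linarith
    · obtain ⟨k, hk⟩ := Nat.exists_eq_succ_of_ne_zero hp.ne'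
      have := Nat.find_min hex (m := k) (by omega)
      push Not at this
      rw [hk, Nat.succ_eq_add_one, pow_succ]; linarith
  have hmem : i ∈ Finset.range (K + 1) := by rw [Finset.mem_range]; omega
  unfold Phi
  rw [← Finset.sum_add_distrib, Finset.sum_div, ← Finset.add_sum_erase _ _ hmem,
    ← Finset.add_sum_erase (Finset.range (K + 1)) (fun x => (hub (2 ^ x) ‖u‖ + hub (2 ^ x) ‖v‖) / 2) hmem]
  have h1 := hub_mid_strong (2 ^ i) (by positivity) u v ((le_max_left _ _).trans hs)
    ((le_max_right _ _).trans hs)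
  have h2 : ∑ x ∈ (Finset.range (K + 1)).erase i, hub (2 ^ x) ‖(1 / 2 : ℂ) * (u + v)‖ ≤
      ∑ x ∈ (Finset.range (K + 1)).erase i, (hub (2 ^ x) ‖u‖ + hub (2 ^ x) ‖v‖) / 2 :=
    Finset.sum_le_sum fun i _ => hub_mid _ (by positivity) u v
  have h3 : ‖u - v‖ ^ 2 / (16 * (1 + m)) ≤ ‖u - v‖ ^ 2 / (8 * 2 ^ i) := by
    apply div_le_div_of_nonneg_left (by positivity) (by positivity)
    linarith
  linarith

lemma hub_meas (τ : ℝ) : Measurable (hub τ) := by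
  unfold hub
  exact Measurable.ite measurableSet_Iic (by fun_prop) (by fun_prop)

lemma Phi_meas (K : ℕ) : Measurable (Phi K) := by
  unfold Phi
  exact Finset.measurable_fun_sum _ fun i _ => hub_meas _

end

open MeasureTheory

noncomputable section

lemma int_bd {Ω E : Type*} [MeasurableSpace Ω] [NormedAddCommGroup E] (P : Measure Ω) [IsProbabilityMeasure P]
    (g : Ω → E) (hg : AEStronglyMeasurable g P) (C : ℝ) (hC : ∀ ω, ‖g ω‖ ≤ C) : Integrable g P :=
  Integrable.of_bound hg C (Filter.Eventually.of_forall hC)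

/-- Cauchy-Schwarz for integrals -/
lemma cs_int {Ω : Type*} [MeasurableSpace Ω] (P : Measure Ω) (f g : Ω → ℝ)
    (hf : Integrable (fun ω => f ω ^ 2) P) (hg : Integrable (fun ω => g ω ^ 2) P)
    (hfg : Integrable (fun ω => f ω * g ω) P) :
    ∫ ω, f ω * g ω ∂P ≤ Real.sqrt (∫ ω, f ω ^ 2 ∂P) * Real.sqrt (∫ ω, g ω ^ 2 ∂P) := by
  set A := ∫ ω, f ω ^ 2 ∂P
  set B := ∫ ω, g ω ^ 2 ∂P
  set X := ∫ ω, f ω * g ω ∂P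
  have hq : ∀ t : ℝ, 0 ≤ A * (t * t) + (-2 * X) * t + B := by
    intro t
    have h1 : 0 ≤ ∫ ω, (t * f ω - g ω) ^ 2 ∂P := integral_nonneg fun ω => sq_nonneg _
    have h2 : ∫ ω, (t * f ω - g ω) ^ 2 ∂P = t ^ 2 * A - 2 * t * X + B := by
      have : (fun ω => (t * f ω - g ω) ^ 2) = fun ω =>
          (t ^ 2 * f ω ^ 2 - 2 * t * (f ω * g ω)) + g ω ^ 2 := by
        funext ω; ring
      have hs : Integrable (fun ω => t ^ 2 * f ω ^ 2 - 2 * t * (f ω * g ω)) P :=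
        (hf.const_mul _).sub (hfg.const_mul _)
      rw [this, integral_add hs hg,
        integral_sub (hf.const_mul _) (hfg.const_mul _), integral_const_mul, integral_const_mul]
    rw [h2] at h1
    linarith
  have hd := discrim_le_zero hq
  unfold discrim at hd
  have hA : 0 ≤ A := integral_nonneg fun ω => sq_nonneg _
  have hB : 0 ≤ B := integral_nonneg fun ω => sq_nonneg _
  rw [← Real.sqrt_mul hA]
  apply Real.le_sqrt_of_sq_le
  nlinarith

/-- a bounded orthonormal system -/
structure BOS {Ω : Type*} [MeasurableSpace Ω] (P : Measure Ω) {n : ℕ} (φ : Fin n → Ω → ℂ) (L : ℝ) :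
    Prop where
  meas : ∀ j, Measurable (φ j)
  bd : ∀ j ω, ‖φ j ω‖ ≤ L
  orth : ∀ i j, (∫ ω, (starRingEnd ℂ) (φ i ω) * φ j ω ∂P) = if i = j then 1 else 0
  one : 1 ≤ L

def fa {Ω : Type*} {n : ℕ} (φ : Fin n → Ω → ℂ) (a : Fin n → ℂ) (ω : Ω) : ℂ := ∑ j, a j * φ j ω

lemma fa_add {Ω : Type*} {n : ℕ} (φ : Fin n → Ω → ℂ) (a b : Fin n → ℂ) (ω : Ω) :
    fa φ (a + b) ω = fa φ a ω + fa φ b ω := by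
  simp [fa, add_mul, Finset.sum_add_distrib]

lemma fa_sub {Ω : Type*} {n : ℕ} (φ : Fin n → Ω → ℂ) (a b : Fin n → ℂ) (ω : Ω) :
    fa φ (a - b) ω = fa φ a ω - fa φ b ω := by
  simp [fa, sub_mul, Finset.sum_sub_distrib]

lemma fa_smul {Ω : Type*} {n : ℕ} (φ : Fin n → Ω → ℂ) (c : ℝ) (a : Fin n → ℂ) (ω : Ω) :
    fa φ (c • a) ω = c * fa φ a ω := by
  simp [fa, Finset.mul_sum, mul_assoc]

def none1 {Ω : Type*} [MeasurableSpace Ω] (P : Measure Ω) {n : ℕ} (φ : Fin n → Ω → ℂ) (a : Fin n → ℂ) : ℝ :=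
  ∫ ω, ‖fa φ a ω‖ ∂P

def etwo {n : ℕ} (a : Fin n → ℂ) : ℝ := ltwo Finset.univ (fun j => ‖a j‖)

lemma etwo_nonneg {n : ℕ} (a : Fin n → ℂ) : 0 ≤ etwo a := ltwo_nonneg _ _

lemma etwo_sq {n : ℕ} (a : Fin n → ℂ) : etwo a ^ 2 = ∑ j, ‖a j‖ ^ 2 := ltwo_sq _ _

lemma etwo_smul {n : ℕ} (c : ℝ) (hc : 0 ≤ c) (a : Fin n → ℂ) : etwo (c • a) = c * etwo a := by
  unfold etwo
  rw [← ltwo_smul _ _ hc]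
  congr 1; funext j
  simp [abs_of_nonneg hc]

lemma etwo_add {n : ℕ} (a b : Fin n → ℂ) : etwo (a + b) ≤ etwo a + etwo b := by
  unfold etwo
  refine le_trans (ltwo_mono _ _ _ fun j => ?_) (ltwo_add _ _ _)
  rw [abs_of_nonneg (norm_nonneg _)]
  exact norm_add_le _ _

lemma etwo_cont {n : ℕ} : Continuous (etwo : (Fin n → ℂ) → ℝ) := by
  unfold etwo ltwo; fun_prop

lemma etwo_coord {n : ℕ} (a : Fin n → ℂ) (j : Fin n) : ‖a j‖ ≤ etwo a := by
  apply Real.le_sqrt_of_sq_le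
  exact Finset.single_le_sum (f := fun j => ‖a j‖ ^ 2) (fun _ _ => sq_nonneg _) (Finset.mem_univ j)


lemma BOS.fmeas {Ω : Type*} [MeasurableSpace Ω] {P : Measure Ω} [IsProbabilityMeasure P] {n : ℕ}
    {φ : Fin n → Ω → ℂ} {L : ℝ} (H : BOS P φ L) (a : Fin n → ℂ) : Measurable (fa φ a) := by
  unfold fa
  exact Finset.measurable_fun_sum _ fun j _ => (H.meas j).const_mul _

lemma BOS.fbd {Ω : Type*} [MeasurableSpace Ω] {P : Measure Ω} [IsProbabilityMeasure P] {n : ℕ}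
    {φ : Fin n → Ω → ℂ} {L : ℝ} (H : BOS P φ L) (a : Fin n → ℂ) (ω : Ω) : ‖fa φ a ω‖ ≤ L * ∑ j, ‖a j‖ := by
  unfold fa
  rw [Finset.mul_sum]
  refine norm_sum_le_of_le _ fun j _ => ?_
  rw [norm_mul, mul_comm]
  exact mul_le_mul_of_nonneg_right (H.bd j ω) (norm_nonneg _)

lemma BOS.fint {Ω : Type*} [MeasurableSpace Ω] {P : Measure Ω} [IsProbabilityMeasure P] {n : ℕ}
    {φ : Fin n → Ω → ℂ} {L : ℝ} (H : BOS P φ L) (a : Fin n → ℂ) : Integrable (fa φ a) P :=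
  int_bd P _ (H.fmeas a).aestronglyMeasurable _ (H.fbd a)

lemma BOS.fnint {Ω : Type*} [MeasurableSpace Ω] {P : Measure Ω} [IsProbabilityMeasure P] {n : ℕ}
    {φ : Fin n → Ω → ℂ} {L : ℝ} (H : BOS P φ L) (a : Fin n → ℂ) : Integrable (fun ω => ‖fa φ a ω‖) P := (H.fint a).norm

lemma BOS.finner {Ω : Type*} [MeasurableSpace Ω] {P : Measure Ω} [IsProbabilityMeasure P] {n : ℕ}
    {φ : Fin n → Ω → ℂ} {L : ℝ} (H : BOS P φ L) (a b : Fin n → ℂ) :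
    ∫ ω, (starRingEnd ℂ) (fa φ a ω) * fa φ b ω ∂P = ∑ j, (starRingEnd ℂ) (a j) * b j := by
  have e : ∀ ω, (starRingEnd ℂ) (fa φ a ω) * fa φ b ω = ∑ i, ∑ j,
      ((starRingEnd ℂ) (a i) * b j) * ((starRingEnd ℂ) (φ i ω) * φ j ω) := by
    intro ω
    simp only [fa, map_sum, map_mul]
    rw [Finset.sum_mul_sum]
    exact Finset.sum_congr rfl fun i _ => Finset.sum_congr rfl fun j _ => by ring
  have hpint : ∀ i j, Integrable (fun ω => (starRingEnd ℂ) (φ i ω) * φ j ω) P := by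
    intro i j
    have hc : Continuous (starRingEnd ℂ) := Complex.continuous_conj
    refine int_bd P _ ((hc.measurable.comp (H.meas i)).mul (H.meas j)).aestronglyMeasurable (L * L) fun ω => ?_
    rw [norm_mul, RCLike.norm_conj]
    have := H.bd i ω
    have := H.bd j ω
    have := H.one
    gcongr
  simp_rw [e]
  rw [integral_finsetSum _ fun i _ => integrable_finsetSum _ fun j _ => (hpint i j).const_mul _]
  refine Finset.sum_congr rfl fun i _ => ?_
  rw [integral_finsetSum _ fun j _ => (hpint i j).const_mul _]
  simp_rw [integral_const_mul, H.orth]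
  simp

lemma BOS.fsqint {Ω : Type*} [MeasurableSpace Ω] {P : Measure Ω} [IsProbabilityMeasure P] {n : ℕ}
    {φ : Fin n → Ω → ℂ} {L : ℝ} (H : BOS P φ L) (a : Fin n → ℂ) : Integrable (fun ω => ‖fa φ a ω‖ ^ 2) P := by
  refine int_bd P _ ((H.fmeas a).norm.pow_const 2).aestronglyMeasurable ((L * ∑ j, ‖a j‖) ^ 2) fun ω => ?_
  rw [Real.norm_of_nonneg (by positivity)]
  exact pow_le_pow_left₀ (norm_nonneg _) (H.fbd a ω) 2

lemma BOS.l2 {Ω : Type*} [MeasurableSpace Ω] {P : Measure Ω} [IsProbabilityMeasure P] {n : ℕ}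
    {φ : Fin n → Ω → ℂ} {L : ℝ} (H : BOS P φ L) (a : Fin n → ℂ) : ∫ ω, ‖fa φ a ω‖ ^ 2 ∂P = etwo a ^ 2 := by
  have h := H.finner a a
  have e1 : ∀ z : ℂ, (starRingEnd ℂ) z * z = ((‖z‖ ^ 2 : ℝ) : ℂ) := by
    intro z; rw [Complex.conj_mul']; simp
  simp_rw [e1] at h
  rw [integral_complex_ofReal, ← Complex.ofReal_sum] at h
  rw [etwo_sq]
  exact_mod_cast h

lemma BOS.coef {Ω : Type*} [MeasurableSpace Ω] {P : Measure Ω} [IsProbabilityMeasure P] {n : ℕ}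
    {φ : Fin n → Ω → ℂ} {L : ℝ} (H : BOS P φ L) (a : Fin n → ℂ) (j : Fin n) : ‖a j‖ ≤ L * none1 P φ a := by
  have h := H.finner (Pi.single j 1) a
  have e1 : ∑ i, (starRingEnd ℂ) ((Pi.single j 1 : Fin n → ℂ) i) * a i = a j := by
    rw [Finset.sum_eq_single j]
    · simp
    · intro b _ hb; simp [hb]
    · simp
  rw [e1] at h
  rw [← h]
  refine (norm_integral_le_integral_norm _).trans ?_
  unfold none1
  rw [← integral_const_mul]
  apply integral_mono_of_nonneg
  · exact Filter.Eventually.of_forall fun ω => norm_nonneg _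
  · exact (H.fnint a).const_mul _
  · refine Filter.Eventually.of_forall fun ω => ?_
    simp only
    rw [norm_mul, RCLike.norm_conj]
    have : fa φ (Pi.single j 1) ω = φ j ω := by
      unfold fa
      rw [Finset.sum_eq_single j]
      · simp
      · intro b _ hb; simp [hb]
      · simp
    rw [this]
    exact mul_le_mul_of_nonneg_right (H.bd j ω) (norm_nonneg _)

lemma none1_nonneg {Ω : Type*} [MeasurableSpace Ω] {P : Measure Ω} {n : ℕ}
    {φ : Fin n → Ω → ℂ} (a : Fin n → ℂ) : 0 ≤ none1 P φ a := integral_nonneg fun _ => norm_nonneg _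

lemma BOS.n1_add {Ω : Type*} [MeasurableSpace Ω] {P : Measure Ω} [IsProbabilityMeasure P] {n : ℕ}
    {φ : Fin n → Ω → ℂ} {L : ℝ} (H : BOS P φ L) (a b : Fin n → ℂ) : none1 P φ (a + b) ≤ none1 P φ a + none1 P φ b := by
  unfold none1
  rw [← integral_add (H.fnint a) (H.fnint b)]
  apply integral_mono (H.fnint _) ((H.fnint a).add (H.fnint b))
  intro ω
  simp only [fa_add, Pi.add_apply]
  exact norm_add_le _ _

lemma n1_smul {Ω : Type*} [MeasurableSpace Ω] {P : Measure Ω} {n : ℕ}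
    {φ : Fin n → Ω → ℂ} (c : ℝ) (hc : 0 ≤ c) (a : Fin n → ℂ) : none1 P φ (c • a) = c * none1 P φ a := by
  unfold none1
  rw [← integral_const_mul]
  simp_rw [fa_smul, norm_mul, Complex.norm_real, Real.norm_of_nonneg hc]

lemma BOS.n1_le {Ω : Type*} [MeasurableSpace Ω] {P : Measure Ω} [IsProbabilityMeasure P] {n : ℕ}
    {φ : Fin n → Ω → ℂ} {L : ℝ} (H : BOS P φ L) (a : Fin n → ℂ) : none1 P φ a ≤ L * n * ‖a‖ := by
  have h1 : none1 P φ a ≤ ∫ ω, (L * ∑ j, ‖a j‖) ∂P :=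
    integral_mono (H.fnint a) (integrable_const _) (H.fbd a)
  simp only [integral_const, probReal_univ, smul_eq_mul, one_mul] at h1
  refine h1.trans ?_
  have h2 : ∑ j, ‖a j‖ ≤ ∑ j : Fin n, ‖a‖ := Finset.sum_le_sum fun j _ => norm_le_pi_norm a j
  simp only [Finset.sum_const, Finset.card_univ, Fintype.card_fin, nsmul_eq_mul] at h2
  have := H.one
  calc L * ∑ j, ‖a j‖ ≤ L * (n * ‖a‖) := by gcongr
    _ = _ := by ring

lemma BOS.n1_cont {Ω : Type*} [MeasurableSpace Ω] {P : Measure Ω} [IsProbabilityMeasure P] {n : ℕ}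
    {φ : Fin n → Ω → ℂ} {L : ℝ} (H : BOS P φ L) : Continuous (none1 P φ) := by
  refine (LipschitzWith.of_le_add_mul' (L * n) fun a b => ?_).continuous
  have h1 := H.n1_add b (a - b)
  have h2 := H.n1_le (a - b)
  rw [dist_eq_norm]
  simp only [add_sub_cancel] at h1
  linarith


/-- the convex body -/
def TT {Ω : Type*} [MeasurableSpace Ω] (P : Measure Ω) {n : ℕ} (φ : Fin n → Ω → ℂ) (M : ℝ) :
    Set (Fin n → ℂ) := {a | none1 P φ a ≤ 1 ∧ etwo a ≤ M}

/-- the potential function -/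
def FF {Ω : Type*} [MeasurableSpace Ω] (P : Measure Ω) {n : ℕ} (φ : Fin n → Ω → ℂ) (M : ℝ) (K : ℕ)
    (a : Fin n → ℂ) : ℝ := ∫ ω, Phi K ‖fa φ a ω‖ ∂P + (etwo a / M) ^ 2

def NN {Ω : Type*} [MeasurableSpace Ω] (P : Measure Ω) {n : ℕ} (φ : Fin n → Ω → ℂ) (M : ℝ)
    (a : Fin n → ℂ) : ℝ := (none1 P φ a + etwo a / M) / 9


lemma BOS.T_compact {Ω : Type*} [MeasurableSpace Ω] {P : Measure Ω} [IsProbabilityMeasure P] {n : ℕ}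
    {φ : Fin n → Ω → ℂ} {L : ℝ} (H : BOS P φ L) (M : ℝ) : IsCompact (TT P φ M) := by
  apply Metric.isCompact_of_isClosed_isBounded
  · exact (isClosed_le H.n1_cont continuous_const).inter (isClosed_le etwo_cont continuous_const)
  · refine (Metric.isBounded_closedBall (x := (0 : Fin n → ℂ)) (r := |M|)).subset ?_
    intro a ha
    rw [mem_closedBall_zero_iff]
    refine (pi_norm_le_iff_of_nonneg (abs_nonneg _)).2 fun j => ?_
    exact (etwo_coord a j).trans (ha.2.trans (le_abs_self _))

lemma BOS.T_convex {Ω : Type*} [MeasurableSpace Ω] {P : Measure Ω} [IsProbabilityMeasure P] {n : ℕ}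
    {φ : Fin n → Ω → ℂ} {L : ℝ} (H : BOS P φ L) (M : ℝ) : Convex ℝ (TT P φ M) := by
  intro a ha b hb s t hs ht hst
  constructor
  · have h1 := H.n1_add (s • a) (t • b)
    rw [n1_smul s hs, n1_smul t ht] at h1
    have := ha.1
    have := hb.1
    nlinarith
  · have h1 := etwo_add (s • a) (t • b)
    rw [etwo_smul s hs, etwo_smul t ht] at h1
    have h2 := mul_le_mul_of_nonneg_left ha.2 hs
    have h3 := mul_le_mul_of_nonneg_left hb.2 ht
    have : M = s * M + t * M := by rw [← add_mul, hst, one_mul]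
    linarith

lemma BOS.phi_int {Ω : Type*} [MeasurableSpace Ω] {P : Measure Ω} [IsProbabilityMeasure P] {n : ℕ}
    {φ : Fin n → Ω → ℂ} {L : ℝ} (H : BOS P φ L) (K : ℕ) (a : Fin n → ℂ) : Integrable (fun ω => Phi K ‖fa φ a ω‖) P := by
  refine ((H.fnint a).const_mul (K + 1)).mono'
    ((Phi_meas K).comp (H.fmeas a).norm).aestronglyMeasurable (Filter.Eventually.of_forall fun ω => ?_)
  rw [Real.norm_of_nonneg (Phi_nonneg _ _)]
  exact Phi_le K _ (norm_nonneg _)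

lemma BOS.F_cont {Ω : Type*} [MeasurableSpace Ω] {P : Measure Ω} [IsProbabilityMeasure P] {n : ℕ}
    {φ : Fin n → Ω → ℂ} {L : ℝ} (H : BOS P φ L) (M : ℝ) (K : ℕ) : Continuous (FF P φ M K) := by
  unfold FF
  refine Continuous.add ?_ (by have := etwo_cont (n := n); fun_prop)
  have hL := H.one
  refine (LipschitzWith.of_le_add_mul' ((K + 1) * (L * n)) fun a b => ?_).continuous
  have h1 : ∫ ω, Phi K ‖fa φ a ω‖ ∂P ≤ ∫ ω, (Phi K ‖fa φ b ω‖ + (K + 1) * ‖fa φ (a - b) ω‖) ∂P := by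
    apply integral_mono (H.phi_int K a) ((H.phi_int K b).add ((H.fnint _).const_mul _))
    intro ω
    refine (Phi_lip K _ ‖fa φ b ω‖ (norm_nonneg _)).trans ?_
    have h0 : (0:ℝ) ≤ (K:ℝ) + 1 := by positivity
    have h5 := mul_le_mul_of_nonneg_left (abs_norm_sub_norm_le (fa φ a ω) (fa φ b ω)) h0
    simp only [fa_sub, Pi.add_apply]
    linarith
  rw [integral_add (H.phi_int K b) ((H.fnint _).const_mul _), integral_const_mul] at h1
  have h2 := H.n1_le (a - b)
  rw [dist_eq_norm]
  have h3 : ((K:ℝ) + 1) * ∫ ω, ‖fa φ (a - b) ω‖ ∂P ≤ (K + 1) * (L * n * ‖a - b‖) := by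
    gcongr
    exact h2
  linarith

lemma F_zero {Ω : Type*} [MeasurableSpace Ω] {P : Measure Ω} {n : ℕ}
    {φ : Fin n → Ω → ℂ} (M : ℝ) (K : ℕ) : FF P φ M K 0 = 0 := by
  have : ∀ ω, fa φ 0 ω = 0 := fun ω => by simp [fa]
  have e : etwo (0 : Fin n → ℂ) = 0 := by simp [etwo, ltwo]
  simp [FF, this, Phi_zero, e]

lemma F_nonneg {Ω : Type*} [MeasurableSpace Ω] {P : Measure Ω} {n : ℕ}
    {φ : Fin n → Ω → ℂ} (M : ℝ) (K : ℕ) (a : Fin n → ℂ) : 0 ≤ FF P φ M K a :=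
  add_nonneg (integral_nonneg fun _ => Phi_nonneg _ _) (sq_nonneg _)

lemma BOS.F_le {Ω : Type*} [MeasurableSpace Ω] {P : Measure Ω} [IsProbabilityMeasure P] {n : ℕ}
    {φ : Fin n → Ω → ℂ} {L : ℝ} (H : BOS P φ L) (M : ℝ) (hM : 1 ≤ M) (K : ℕ) (a : Fin n → ℂ) (ha : a ∈ TT P φ M) : FF P φ M K a ≤ K + 2 := by
  unfold FF
  have h1 : ∫ ω, Phi K ‖fa φ a ω‖ ∂P ≤ ∫ ω, (K + 1) * ‖fa φ a ω‖ ∂P :=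
    integral_mono (H.phi_int K a) ((H.fnint a).const_mul _) fun ω => Phi_le K _ (norm_nonneg _)
  rw [integral_const_mul] at h1
  have h2 : ((K:ℝ) + 1) * ∫ ω, ‖fa φ a ω‖ ∂P ≤ (K + 1) * 1 := by
    gcongr; exact ha.1
  have h3 : (etwo a / M) ^ 2 ≤ 1 := by
    have : etwo a / M ≤ 1 := by rw [div_le_one (by linarith)]; exact ha.2
    have h0 : 0 ≤ etwo a / M := div_nonneg (etwo_nonneg _) (by linarith)
    nlinarith
  linarith


end

open MeasureTheory

noncomputable section

lemma gap_pt (K : ℕ) (M t : ℝ) (hM : 1 ≤ M) (hK : M ^ 2 ≤ 2 ^ K) (ht : 0 ≤ t) (u v : ℂ) :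
    2 * t * ‖u - v‖ ≤ 16 * ((Phi K ‖u‖ + Phi K ‖v‖) / 2 - Phi K ‖(1 / 2 : ℂ) * (u + v)‖)
      + t ^ 2 * (1 + max ‖u‖ ‖v‖) + 2 * t / M ^ 2 * (‖u - v‖ * max ‖u‖ ‖v‖) := by
  have hm0 : 0 ≤ max ‖u‖ ‖v‖ := le_max_of_le_left (norm_nonneg _)
  have hD : 0 ≤ ‖u - v‖ := norm_nonneg _
  have hM2 : 0 < M ^ 2 := by positivity
  by_cases h : max ‖u‖ ‖v‖ ≤ 2 ^ K
  · have h1 := Phi_mid_strong K u v h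
    set m := max ‖u‖ ‖v‖
    set D := ‖u - v‖
    have h2 : 2 * t * D ≤ 16 * (D ^ 2 / (16 * (1 + m))) + t ^ 2 * (1 + m) := by
      have e : 16 * (D ^ 2 / (16 * (1 + m))) = D ^ 2 / (1 + m) := by field_simp
      rw [e]
      have : 0 ≤ (D - t * (1 + m)) ^ 2 / (1 + m) := by positivity
      have e2 : (D - t * (1 + m)) ^ 2 / (1 + m) = D ^ 2 / (1 + m) - 2 * t * D + t ^ 2 * (1 + m) := by
        field_simp; ring
      linarith
    have h3 : 0 ≤ 2 * t / M ^ 2 * (D * m) := by positivity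
    linarith
  · have h1 := Phi_mid K u v
    push Not at h
    set m := max ‖u‖ ‖v‖
    set D := ‖u - v‖
    have h2 : 2 * t * D ≤ 2 * t / M ^ 2 * (D * m) := by
      have e : 2 * t / M ^ 2 * (D * m) = 2 * t * D * (m / M ^ 2) := by field_simp
      rw [e]
      have : 1 ≤ m / M ^ 2 := by rw [le_div_iff₀ hM2]; linarith
      have h0 : 0 ≤ 2 * t * D := by positivity
      nlinarith
    have h3 : 0 ≤ t ^ 2 * (1 + m) := by positivity
    linarith

lemma etwo_par {n : ℕ} (a b : Fin n → ℂ) :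
    etwo ((1 / 2 : ℝ) • (a + b)) ^ 2 = (etwo a ^ 2 + etwo b ^ 2) / 2 - etwo (a - b) ^ 2 / 4 := by
  simp only [etwo_sq]
  rw [← Finset.sum_add_distrib, Finset.sum_div, Finset.sum_div, ← Finset.sum_sub_distrib]
  refine Finset.sum_congr rfl fun j _ => ?_
  rw [Pi.sub_apply, ← par_c]
  simp [← mul_add]

lemma conv_num (A B G : ℝ) (hA : 0 ≤ A) (hB : 0 ≤ B) (hG : 0 ≤ G)
    (h : ∀ t, 0 ≤ t → 2 * t * A ≤ 16 * G + 3 * t ^ 2 + 2 * t * (1.42 * B)) :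
    ((A + B) / 9) ^ 2 ≤ G + B ^ 2 / 4 := by
  by_cases hc : A ≤ 1.42 * B
  · have : ((A + B) / 9) ^ 2 ≤ ((2.42 * B) / 9) ^ 2 := by
      apply pow_le_pow_left₀ (by positivity); linarith
    nlinarith [sq_nonneg B]
  · push Not at hc
    have h1 := h ((A - 1.42 * B) / 3) (by linarith)
    set x := A - 1.42 * B with hx
    have hA' : A = x + 1.42 * B := by rw [hx]; ring
    have h2 : x ^ 2 / 48 ≤ G := by rw [hA'] at h1; nlinarith
    rw [hA']
    have h3 : ((x + 1.42 * B + B) / 9) ^ 2 ≤ x ^ 2 / 48 + B ^ 2 / 4 := by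
      nlinarith [sq_nonneg (x * 4 - 48 * 2.42 * B), sq_nonneg x, sq_nonneg B]
    linarith

lemma BOS.F_conv {Ω : Type*} [MeasurableSpace Ω] {P : Measure Ω} [IsProbabilityMeasure P] {n : ℕ}
    {φ : Fin n → Ω → ℂ} {L : ℝ} (H : BOS P φ L) (M : ℝ) (hM : 1 ≤ M) (K : ℕ) (hK : M ^ 2 ≤ 2 ^ K)
    (a b : Fin n → ℂ) (ha : a ∈ TT P φ M) (hb : b ∈ TT P φ M) :
    FF P φ M K ((1 / 2 : ℝ) • (a + b)) ≤ (FF P φ M K a + FF P φ M K b) / 2 - NN P φ M (a - b) ^ 2 := by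
  have hM0 : 0 < M := by linarith
  set B := etwo (a - b) / M with hB
  have hB0 : 0 ≤ B := div_nonneg (etwo_nonneg _) hM0.le
  set A := none1 P φ (a - b) with hA
  set G := (∫ ω, Phi K ‖fa φ a ω‖ ∂P + ∫ ω, Phi K ‖fa φ b ω‖ ∂P) / 2 -
    ∫ ω, Phi K ‖fa φ ((1 / 2 : ℝ) • (a + b)) ω‖ ∂P with hG
  have hmid : ∀ ω, fa φ ((1 / 2 : ℝ) • (a + b)) ω = (1 / 2 : ℂ) * (fa φ a ω + fa φ b ω) := by
    intro ω; rw [fa_smul, fa_add]; simp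
  have hia := H.phi_int K a
  have hib := H.phi_int K b
  have him := H.phi_int K ((1 / 2 : ℝ) • (a + b))
  have higap : Integrable (fun ω => (Phi K ‖fa φ a ω‖ + Phi K ‖fa φ b ω‖) / 2 -
      Phi K ‖fa φ ((1 / 2 : ℝ) • (a + b)) ω‖) P := ((hia.add hib).div_const 2).sub him
  have hGi : ∫ ω, ((Phi K ‖fa φ a ω‖ + Phi K ‖fa φ b ω‖) / 2 -
      Phi K ‖fa φ ((1 / 2 : ℝ) • (a + b)) ω‖) ∂P = G := by
    have hab : Integrable (fun ω => (Phi K ‖fa φ a ω‖ + Phi K ‖fa φ b ω‖) / 2) P :=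
      (hia.add hib).div_const 2
    rw [integral_sub hab him, integral_div, integral_add hia hib]
  set m : Ω → ℝ := fun ω => max ‖fa φ a ω‖ ‖fa φ b ω‖ with hm
  have hmm : Measurable m := (H.fmeas a).norm.max (H.fmeas b).norm
  have hmnn : ∀ ω, 0 ≤ m ω := fun ω => le_max_of_le_left (norm_nonneg _)
  have hmle : ∀ ω, m ω ≤ ‖fa φ a ω‖ + ‖fa φ b ω‖ := fun ω =>
    max_le (by linarith [norm_nonneg (fa φ b ω)]) (by linarith [norm_nonneg (fa φ a ω)])
  have hmsq : ∀ ω, m ω ^ 2 ≤ ‖fa φ a ω‖ ^ 2 + ‖fa φ b ω‖ ^ 2 := by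
    intro ω
    rcases max_choice ‖fa φ a ω‖ ‖fa φ b ω‖ with h | h
    · simp only [hm, h]; nlinarith [sq_nonneg ‖fa φ b ω‖]
    · simp only [hm, h]; nlinarith [sq_nonneg ‖fa φ a ω‖]
  have hmint : Integrable m P := ((H.fnint a).add (H.fnint b)).mono' hmm.aestronglyMeasurable
    (Filter.Eventually.of_forall fun ω => by rw [Real.norm_of_nonneg (hmnn ω)]; exact hmle ω)
  have hmsqint : Integrable (fun ω => m ω ^ 2) P := ((H.fsqint a).add (H.fsqint b)).mono'
    (hmm.pow_const 2).aestronglyMeasurable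
    (Filter.Eventually.of_forall fun ω => by rw [Real.norm_of_nonneg (sq_nonneg _)]; exact hmsq ω)
  have hDmint : Integrable (fun ω => ‖fa φ (a - b) ω‖ * m ω) P := by
    refine ((H.fsqint (a - b)).add hmsqint).mono' ((H.fmeas _).norm.mul hmm).aestronglyMeasurable
      (Filter.Eventually.of_forall fun ω => ?_)
    rw [Real.norm_of_nonneg (mul_nonneg (norm_nonneg _) (hmnn ω))]
    simp only [Pi.add_apply]
    nlinarith [sq_nonneg (‖fa φ (a - b) ω‖ - m ω), sq_nonneg (‖fa φ (a - b) ω‖ + m ω)]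
  have hDm : ∫ ω, ‖fa φ (a - b) ω‖ * m ω ∂P ≤ 1.42 * M * etwo (a - b) := by
    refine (cs_int P _ _ (H.fsqint _) hmsqint hDmint).trans ?_
    rw [H.l2, Real.sqrt_sq (etwo_nonneg _)]
    have : ∫ ω, m ω ^ 2 ∂P ≤ (1.42 * M) ^ 2 := by
      have h1 : ∫ ω, m ω ^ 2 ∂P ≤ ∫ ω, (‖fa φ a ω‖ ^ 2 + ‖fa φ b ω‖ ^ 2) ∂P :=
        integral_mono hmsqint ((H.fsqint a).add (H.fsqint b)) hmsq
      rw [integral_add (H.fsqint a) (H.fsqint b), H.l2, H.l2] at h1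
      have h2 := pow_le_pow_left₀ (etwo_nonneg a) ha.2 2
      have h3 := pow_le_pow_left₀ (etwo_nonneg b) hb.2 2
      nlinarith
    have h2 : Real.sqrt (∫ ω, m ω ^ 2 ∂P) ≤ 1.42 * M :=
      (Real.sqrt_le_sqrt this).trans (by rw [Real.sqrt_sq (by positivity)])
    have := mul_le_mul_of_nonneg_left h2 (etwo_nonneg (a - b))
    linarith
  have hmi : ∫ ω, m ω ∂P ≤ 2 := by
    have h1 : ∫ ω, m ω ∂P ≤ ∫ ω, (‖fa φ a ω‖ + ‖fa φ b ω‖) ∂P :=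
      integral_mono hmint ((H.fnint a).add (H.fnint b)) hmle
    rw [integral_add (H.fnint a) (H.fnint b)] at h1
    have := ha.1
    have := hb.1
    unfold none1 at *
    linarith
  have hG0 : 0 ≤ G := by
    rw [← hGi]
    refine integral_nonneg fun ω => ?_
    simp only [Pi.zero_apply, hmid]
    linarith [Phi_mid K (fa φ a ω) (fa φ b ω)]
  have key : ((A + B) / 9) ^ 2 ≤ G + B ^ 2 / 4 := by
    refine conv_num A B G (none1_nonneg _) hB0 hG0 fun t ht => ?_
    have i1 : Integrable (fun ω => 16 * ((Phi K ‖fa φ a ω‖ + Phi K ‖fa φ b ω‖) / 2 -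
      Phi K ‖fa φ ((1 / 2 : ℝ) • (a + b)) ω‖)) P := higap.const_mul 16
    have i2' : Integrable (fun ω => 1 + m ω) P := (integrable_const 1).add hmint
    have i2 : Integrable (fun ω => t ^ 2 * (1 + m ω)) P := i2'.const_mul _
    have i3 : Integrable (fun ω => 2 * t / M ^ 2 * (‖fa φ (a - b) ω‖ * m ω)) P := hDmint.const_mul _
    have i12 : Integrable (fun ω => 16 * ((Phi K ‖fa φ a ω‖ + Phi K ‖fa φ b ω‖) / 2 -
      Phi K ‖fa φ ((1 / 2 : ℝ) • (a + b)) ω‖) + t ^ 2 * (1 + m ω)) P := i1.add i2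
    have h1 : ∫ ω, 2 * t * ‖fa φ (a - b) ω‖ ∂P ≤ ∫ ω, (16 * ((Phi K ‖fa φ a ω‖ + Phi K ‖fa φ b ω‖) / 2 -
      Phi K ‖fa φ ((1 / 2 : ℝ) • (a + b)) ω‖) + t ^ 2 * (1 + m ω) +
        2 * t / M ^ 2 * (‖fa φ (a - b) ω‖ * m ω)) ∂P := by
      apply integral_mono ((H.fnint _).const_mul _) (i12.add i3)
      intro ω
      simp only [fa_sub, hmid]
      exact gap_pt K M t hM hK ht _ _
    rw [integral_add i12 i3, integral_add i1 i2, integral_const_mul, integral_const_mul, hGi,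
      integral_const_mul, integral_const_mul, integral_add (integrable_const 1) hmint] at h1
    simp only [integral_const, probReal_univ, smul_eq_mul, mul_one] at h1
    have h2 : 2 * t / M ^ 2 * ∫ ω, ‖fa φ (a - b) ω‖ * m ω ∂P ≤ 2 * t * (1.42 * B) := by
      have h3 := mul_le_mul_of_nonneg_left hDm (show 0 ≤ 2 * t / M ^ 2 by positivity)
      have e : 2 * t / M ^ 2 * (1.42 * M * etwo (a - b)) = 2 * t * (1.42 * B) := by
        rw [hB]; field_simp
      linarith
    have h4 : t ^ 2 * (1 + ∫ ω, m ω ∂P) ≤ t ^ 2 * 3 :=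
      mul_le_mul_of_nonneg_left (by linarith) (sq_nonneg t)
    have h5 : A = ∫ ω, ‖fa φ (a - b) ω‖ ∂P := rfl
    rw [← h5] at h1
    linarith
  have hpar := etwo_par a b
  have e1 : FF P φ M K ((1 / 2 : ℝ) • (a + b)) = (FF P φ M K a + FF P φ M K b) / 2 - (G + B ^ 2 / 4) := by
    unfold FF
    rw [hG, hB, div_pow (etwo ((1 / 2 : ℝ) • (a + b))), hpar]
    field_simp
    ring
  rw [e1]
  unfold NN
  linarith

end

open MeasureTheory

noncomputable section

lemma mgf_c {n : ℕ} (c : Fin n → ℂ) (s l : ℝ) (hs : ∑ j, ‖c j‖ ^ 2 ≤ s) :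
    ∑ g : Fin n → Bool, Real.exp (l * ‖∑ j, (sg (g j) : ℂ) * c j‖) ≤ 2 ^ n * (2 * Real.exp (2 * l ^ 2 * s)) := by
  by_cases hl : 0 ≤ l
  swap
  · have h1 : ∀ g : Fin n → Bool, Real.exp (l * ‖∑ j, (sg (g j) : ℂ) * c j‖) ≤ 2 * Real.exp (2 * l ^ 2 * s) := by
      intro g
      have h2 : Real.exp (l * ‖∑ j, (sg (g j) : ℂ) * c j‖) ≤ 1 := by
        rw [Real.exp_le_one_iff]
        push Not at hl
        exact mul_nonpos_of_nonpos_of_nonneg hl.le (norm_nonneg _)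
      have h3 : 1 ≤ Real.exp (2 * l ^ 2 * s) := by
        rw [Real.one_le_exp_iff]
        have : 0 ≤ s := le_trans (Finset.sum_nonneg fun _ _ => sq_nonneg _) hs
        positivity
      linarith
    calc _ ≤ ∑ g : Fin n → Bool, 2 * Real.exp (2 * l ^ 2 * s) := Finset.sum_le_sum fun g _ => h1 g
      _ = _ := by simp
  have hre : ∀ g : Fin n → Bool, (∑ j, (sg (g j) : ℂ) * c j).re = ∑ j, sg (g j) * (c j).re := by
    intro g; simp
  have him : ∀ g : Fin n → Bool, (∑ j, (sg (g j) : ℂ) * c j).im = ∑ j, sg (g j) * (c j).im := by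
    intro g; simp
  have hpt : ∀ g : Fin n → Bool, Real.exp (l * ‖∑ j, (sg (g j) : ℂ) * c j‖) ≤
      (Real.exp (∑ j, sg (g j) * (2 * l * (c j).re)) + Real.exp (∑ j, sg (g j) * (-(2 * l) * (c j).re)) +
       Real.exp (∑ j, sg (g j) * (2 * l * (c j).im)) + Real.exp (∑ j, sg (g j) * (-(2 * l) * (c j).im))) / 2 := by
    intro g
    have e : ∀ (t : ℝ) (d : Fin n → ℝ), ∑ j, sg (g j) * (t * d j) = t * ∑ j, sg (g j) * d j := by
      intro t d; rw [Finset.mul_sum]; exact Finset.sum_congr rfl fun j _ => by ring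
    rw [e, e, e, e, ← hre, ← him]
    set w := ∑ j, (sg (g j) : ℂ) * c j
    have h1 : ‖w‖ ≤ |w.re| + |w.im| := Complex.norm_le_abs_re_add_abs_im w
    have h2 : Real.exp (l * ‖w‖) ≤ Real.exp (l * |w.re|) * Real.exp (l * |w.im|) := by
      rw [← Real.exp_add, ← mul_add]
      exact Real.exp_le_exp.2 (mul_le_mul_of_nonneg_left h1 hl)
    have h3 : ∀ x : ℝ, Real.exp (l * |x|) ^ 2 ≤ Real.exp (2 * l * x) + Real.exp (-(2 * l) * x) := by
      intro x
      rw [← Real.exp_nat_mul]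
      rcases abs_cases x with ⟨h, _⟩ | ⟨h, _⟩
      · rw [h]
        have := Real.exp_pos (-(2 * l) * x)
        have e : ((2:ℕ):ℝ) * (l * x) = 2 * l * x := by push_cast; ring
        rw [e]; linarith
      · rw [h]
        have := Real.exp_pos (2 * l * x)
        have e : ((2:ℕ):ℝ) * (l * -x) = -(2 * l) * x := by push_cast; ring
        rw [e]; linarith
    have h4 := h3 w.re
    have h5 := h3 w.im
    nlinarith [sq_nonneg (Real.exp (l * |w.re|) - Real.exp (l * |w.im|))]
  have hm : ∀ (t : ℝ) (d : Fin n → ℝ), t ^ 2 = (2 * l) ^ 2 → (∀ j, d j ^ 2 ≤ ‖c j‖ ^ 2) →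
      ∑ g : Fin n → Bool, Real.exp (∑ j, sg (g j) * (t * d j)) ≤ 2 ^ n * Real.exp (2 * l ^ 2 * s) := by
    intro t d ht hd
    refine (rad_mgf fun j => t * d j).trans ?_
    gcongr
    simp_rw [mul_pow, ht]
    rw [← Finset.mul_sum]
    have : ∑ j, d j ^ 2 ≤ s := (Finset.sum_le_sum fun j _ => hd j).trans hs
    nlinarith [sq_nonneg l]
  have hdr : ∀ j, (c j).re ^ 2 ≤ ‖c j‖ ^ 2 := fun j => by
    rw [← sq_abs]; exact pow_le_pow_left₀ (abs_nonneg _) (Complex.abs_re_le_norm _) 2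
  have hdi : ∀ j, (c j).im ^ 2 ≤ ‖c j‖ ^ 2 := fun j => by
    rw [← sq_abs]; exact pow_le_pow_left₀ (abs_nonneg _) (Complex.abs_im_le_norm _) 2
  have h1 := hm (2 * l) _ rfl hdr
  have h2 := hm (-(2 * l)) _ (by ring) hdr
  have h3 := hm (2 * l) _ rfl hdi
  have h4 := hm (-(2 * l)) _ (by ring) hdi
  refine (Finset.sum_le_sum fun g _ => hpt g).trans ?_
  rw [← Finset.sum_div, Finset.sum_add_distrib, Finset.sum_add_distrib, Finset.sum_add_distrib]
  linarith

lemma trunc_pt (l τ t : ℝ) (hl : 0 < l) (hτ : 0 ≤ τ) :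
    (if τ < t then t else 0) ^ 2 ≤ 8 / l ^ 2 * Real.exp (-(l * τ / 2)) * Real.exp (l * t) := by
  split_ifs with h
  · rw [mul_assoc, ← Real.exp_add]
    have h1 : l * t / 2 ≤ -(l * τ / 2) + l * t := by nlinarith
    have h2 : (l * t / 2) ^ 2 / 2 ≤ Real.exp (l * t / 2) := by
      have h0 : 0 ≤ l * t / 2 := by have := mul_nonneg hl.le (hτ.trans h.le); linarith
      have := Real.quadratic_le_exp_of_nonneg h0
      linarith
    have h3 := h2.trans (Real.exp_le_exp.2 h1)
    have h4 := mul_le_mul_of_nonneg_left h3 (show 0 ≤ 8 / l ^ 2 by positivity)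
    have e : 8 / l ^ 2 * ((l * t / 2) ^ 2 / 2) = t ^ 2 := by field_simp; ring
    linarith
  · rw [zero_pow two_ne_zero]; positivity

lemma BOS.bad {Ω : Type*} [MeasurableSpace Ω] {P : Measure Ω} [IsProbabilityMeasure P] {n : ℕ}
    {φ : Fin n → Ω → ℂ} {L : ℝ} (H : BOS P φ L) (M : ℝ) (hM : 1 ≤ M) (U : ℝ) (hU : 0 < U)
    (J : Finset (Fin n)) (z : Fin n → ℂ) (hz : ltwo J (fun j => ‖z j‖) ≤ U) :
    ∃ B : Finset (Fin n → Bool), 600 * (B.card : ℝ) ≤ 2 ^ n ∧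
      ∀ g, g ∉ B → ∀ h : Fin n → ℂ, ∑ j ∈ J, sg (g j) * ((starRingEnd ℂ) (z j) * h j).re ≤
        900 * (L * U) * Real.sqrt (1 + Real.log M) * NN P φ M h := by
  classical
  have hL := H.one
  set v := 1 + Real.log M with hv
  have hv1 : 1 ≤ v := by have := Real.log_nonneg hM; linarith
  set σ := L * U with hσ
  have hσ0 : 0 < σ := by positivity
  set r := Real.sqrt v with hr
  have hr1 : 1 ≤ r := by rw [hr]; exact Real.one_le_sqrt.2 hv1
  have hr2 : r ^ 2 = v := Real.sq_sqrt (by linarith)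
  set l := r / σ with hl
  have hl0 : 0 < l := by positivity
  set τ := 8 * σ * r with hτ
  have hτ0 : 0 ≤ τ := by positivity
  set G : (Fin n → Bool) → Fin n → ℂ := fun g j => if j ∈ J then (sg (g j) : ℂ) * z j else 0 with hG
  set Gt : (Fin n → Bool) → Ω → ℝ := fun g ω => if τ < ‖fa φ (G g) ω‖ then ‖fa φ (G g) ω‖ else 0 with hGt
  have hGt0 : ∀ g ω, 0 ≤ Gt g ω := by
    intro g ω; simp only [hGt]; split_ifs; exacts [norm_nonneg _, le_rfl]
  have hGtm : ∀ g, Measurable (Gt g) := fun g =>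
    Measurable.ite (measurableSet_lt measurable_const (H.fmeas _).norm) (H.fmeas _).norm measurable_const
  have hGtle : ∀ g ω, Gt g ω ≤ ‖fa φ (G g) ω‖ := by
    intro g ω; simp only [hGt]; split_ifs; exacts [le_rfl, norm_nonneg _]
  have hGtsq : ∀ g, Integrable (fun ω => Gt g ω ^ 2) P := fun g =>
    (H.fsqint (G g)).mono' ((hGtm g).pow_const 2).aestronglyMeasurable
      (Filter.Eventually.of_forall fun ω => by
        rw [Real.norm_of_nonneg (sq_nonneg _)]
        exact pow_le_pow_left₀ (hGt0 g ω) (hGtle g ω) 2)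
  set W : (Fin n → Bool) → ℝ := fun g => ∫ ω, Gt g ω ^ 2 ∂P with hW
  have hM0 : 0 < M := by linarith
  -- the mean of W
  have hsum : ∑ g, W g ≤ 2 ^ n * (16 * σ ^ 2 / M ^ 2) := by
    simp only [hW]
    rw [← integral_finsetSum _ fun g _ => hGtsq g]
    have hpt : ∀ ω, ∑ g, Gt g ω ^ 2 ≤ 2 ^ n * (16 * σ ^ 2 / M ^ 2) := by
      intro ω
      have h1 : ∀ g, Gt g ω ^ 2 ≤ 8 / l ^ 2 * Real.exp (-(l * τ / 2)) * Real.exp (l * ‖fa φ (G g) ω‖) :=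
        fun g => trunc_pt l τ _ hl0 hτ0
      refine (Finset.sum_le_sum fun g _ => h1 g).trans ?_
      rw [← Finset.mul_sum]
      have h2 := mgf_c (fun j => if j ∈ J then z j * φ j ω else 0) (σ ^ 2) l (by
        have e : ∀ j, ‖(if j ∈ J then z j * φ j ω else 0 : ℂ)‖ ^ 2 ≤ L ^ 2 * (if j ∈ J then ‖z j‖ ^ 2 else 0) := by
          intro j
          split_ifs
          · rw [norm_mul, mul_pow, mul_comm]
            exact mul_le_mul_of_nonneg_right (pow_le_pow_left₀ (norm_nonneg _) (H.bd j ω) 2) (sq_nonneg _)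
          · simp
        refine (Finset.sum_le_sum fun j _ => e j).trans ?_
        rw [← Finset.mul_sum, Finset.sum_ite_mem, Finset.univ_inter, ← ltwo_sq, hσ, mul_pow]
        exact mul_le_mul_of_nonneg_left (pow_le_pow_left₀ (ltwo_nonneg _ _) hz 2) (sq_nonneg _))
      have e3 : ∀ g : Fin n → Bool, ∑ j, (sg (g j) : ℂ) * (if j ∈ J then z j * φ j ω else 0) = fa φ (G g) ω := by
        intro g
        simp only [fa, hG]
        refine Finset.sum_congr rfl fun j _ => ?_
        split_ifs <;> ring
      simp only [e3] at h2
      refine (mul_le_mul_of_nonneg_left h2 (by positivity)).trans ?_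
      have e4 : l * τ / 2 = 4 * v := by rw [hl, hτ, ← hr2]; field_simp; norm_num
      have e5 : 2 * l ^ 2 * σ ^ 2 = 2 * v := by rw [hl, ← hr2]; field_simp
      have e6 : 8 / l ^ 2 = 8 * σ ^ 2 / v := by rw [hl, ← hr2]; field_simp
      rw [e4, e5, e6]
      have e7 : Real.exp (-(4 * v)) * Real.exp (2 * v) ≤ 1 / M ^ 2 := by
        rw [← Real.exp_add]
        have : (1 / M ^ 2) = Real.exp (-(2 * Real.log M)) := by
          rw [Real.exp_neg, two_mul, Real.exp_add, Real.exp_log hM0]; field_simp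
        rw [this]
        apply Real.exp_le_exp.2
        rw [hv]; have := Real.log_nonneg hM; linarith
      have e8 : 8 * σ ^ 2 / v ≤ 8 * σ ^ 2 := div_le_self (by positivity) hv1
      calc 8 * σ ^ 2 / v * Real.exp (-(4 * v)) * (2 ^ n * (2 * Real.exp (2 * v)))
          = 2 ^ n * (2 * ((8 * σ ^ 2 / v) * (Real.exp (-(4 * v)) * Real.exp (2 * v)))) := by ring
        _ ≤ 2 ^ n * (2 * ((8 * σ ^ 2) * (1 / M ^ 2))) := by gcongr
        _ = _ := by ring
    have h3 : ∫ ω, ∑ g, Gt g ω ^ 2 ∂P ≤ ∫ ω, (2 ^ n * (16 * σ ^ 2 / M ^ 2)) ∂P :=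
      integral_mono (integrable_finsetSum _ fun g _ => hGtsq g) (integrable_const _) hpt
    simpa using h3
  have hW0 : ∀ g, 0 ≤ W g := fun g => integral_nonneg fun _ => sq_nonneg _
  set c := (100 * σ * r / M) with hc
  refine ⟨Finset.univ.filter fun g => c ^ 2 < W g, ?_, ?_⟩
  · set B := Finset.univ.filter fun g => c ^ 2 < W g
    have h1 : (B.card : ℝ) * c ^ 2 ≤ ∑ g, W g := by
      rw [← nsmul_eq_mul]
      refine le_trans (Finset.card_nsmul_le_sum B W (c ^ 2) fun g hg => (Finset.mem_filter.1 hg).2.le) ?_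
      exact Finset.sum_le_sum_of_subset_of_nonneg (Finset.subset_univ _) fun g _ _ => hW0 g
    have h2 := h1.trans hsum
    have e : c ^ 2 = 10000 * v * (σ ^ 2 / M ^ 2) := by rw [hc, ← hr2]; field_simp; norm_num
    rw [e] at h2
    have hp : 0 < σ ^ 2 / M ^ 2 := by positivity
    have h3 : (B.card : ℝ) * (10000 * v) ≤ 2 ^ n * 16 := by
      by_contra hcon
      push Not at hcon
      have := mul_lt_mul_of_pos_right hcon hp
      have e2 : 2 ^ n * 16 * (σ ^ 2 / M ^ 2) = 2 ^ n * (16 * σ ^ 2 / M ^ 2) := by ring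
      rw [e2] at this
      linarith
    have h4 : (0:ℝ) ≤ B.card := by positivity
    nlinarith
  · intro g hg h
    have hWg : W g ≤ c ^ 2 := by
      simpa using hg
    have hfi := H.finner (G g) h
    have e1 : ∑ j ∈ J, sg (g j) * ((starRingEnd ℂ) (z j) * h j).re =
        (∫ ω, (starRingEnd ℂ) (fa φ (G g) ω) * fa φ h ω ∂P).re := by
      rw [hfi, Complex.re_sum, ← Finset.univ_inter J, ← Finset.sum_ite_mem]
      refine Finset.sum_congr rfl fun j _ => ?_
      simp only [hG]
      split_ifs
      · rw [map_mul, Complex.conj_ofReal, mul_assoc, Complex.re_ofReal_mul]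
      · simp
    rw [e1]
    refine (Complex.re_le_norm _).trans ((norm_integral_le_integral_norm _).trans ?_)
    have iGf : Integrable (fun ω => Gt g ω * ‖fa φ h ω‖) P := by
      refine ((hGtsq g).add (H.fsqint h)).mono' ((hGtm g).mul (H.fmeas h).norm).aestronglyMeasurable
        (Filter.Eventually.of_forall fun ω => ?_)
      rw [Real.norm_of_nonneg (mul_nonneg (hGt0 _ _) (norm_nonneg _))]
      simp only [Pi.add_apply]
      nlinarith [sq_nonneg (Gt g ω - ‖fa φ h ω‖), sq_nonneg (Gt g ω + ‖fa φ h ω‖)]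
    have h1 : ∫ ω, ‖(starRingEnd ℂ) (fa φ (G g) ω) * fa φ h ω‖ ∂P ≤
        ∫ ω, (τ * ‖fa φ h ω‖ + Gt g ω * ‖fa φ h ω‖) ∂P := by
      apply integral_mono_of_nonneg
      · exact Filter.Eventually.of_forall fun ω => norm_nonneg _
      · exact ((H.fnint h).const_mul _).add iGf
      · refine Filter.Eventually.of_forall fun ω => ?_
        simp only
        rw [norm_mul, RCLike.norm_conj, ← add_mul]
        refine mul_le_mul_of_nonneg_right ?_ (norm_nonneg _)
        simp only [hGt]
        split_ifs with hlt
        · linarith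
        · linarith
    rw [integral_add ((H.fnint h).const_mul _) iGf, integral_const_mul] at h1
    have h2 := cs_int P _ _ (hGtsq g) (H.fsqint h) iGf
    rw [H.l2, Real.sqrt_sq (etwo_nonneg _)] at h2
    have hc0 : 0 ≤ c := by positivity
    have h3 : Real.sqrt (∫ ω, Gt g ω ^ 2 ∂P) ≤ c := (Real.sqrt_le_sqrt hWg).trans (by rw [Real.sqrt_sq hc0])
    have h4 := mul_le_mul_of_nonneg_right h3 (etwo_nonneg h)
    refine h1.trans ?_
    unfold NN
    have e9 : c * etwo h = 100 * σ * r * (etwo h / M) := by rw [hc]; field_simp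
    have hn1 := none1_nonneg (P := P) (φ := φ) h
    have h5 : τ * ∫ ω, ‖fa φ h ω‖ ∂P ≤ 100 * σ * r * none1 P φ h := by
      unfold none1 at *
      refine mul_le_mul_of_nonneg_right ?_ hn1
      rw [hτ]; nlinarith [mul_pos hσ0 (lt_of_lt_of_le one_pos hr1)]
    calc _ ≤ 100 * σ * r * none1 P φ h + 100 * σ * r * (etwo h / M) := by linarith
      _ = _ := by ring

end

open MeasureTheory

noncomputable section

lemma exists_pow_two (x : ℝ) (hx : 1 ≤ x) : ∃ K : ℕ, x ≤ 2 ^ K ∧ (K : ℝ) ≤ 1 + 1.4428 * Real.log x := by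
  have hl := Real.log_two_gt_d9
  have hlx := Real.log_nonneg hx
  refine ⟨⌈Real.log x / Real.log 2⌉₊, ?_, ?_⟩
  · have h1 := Nat.le_ceil (Real.log x / Real.log 2)
    rw [div_le_iff₀ (by linarith)] at h1
    rw [← Real.log_le_log_iff (by linarith) (by positivity), Real.log_pow]
    exact h1
  · have h1 := Nat.ceil_lt_add_one (show 0 ≤ Real.log x / Real.log 2 by positivity)
    have h2 : Real.log x / Real.log 2 ≤ 1.4428 * Real.log x := by
      rw [div_le_iff₀ (by linarith)]; nlinarith
    linarith

lemma log_three_gt : 1.09 < Real.log 3 := by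
  have h1 := Real.log_two_gt_d9
  have h2 : Real.log 3 = (Real.log 2 * 11 + Real.log (3 ^ 7 / 2 ^ 11)) / 7 := by
    rw [Real.log_div (by norm_num) (by norm_num), Real.log_pow, Real.log_pow]; push_cast; ring
  have h3 : 0 ≤ Real.log ((3:ℝ) ^ 7 / 2 ^ 11) := Real.log_nonneg (by norm_num)
  have h4 : Real.log ((3:ℝ) ^ 7 / 2 ^ 11) ≥ 1 - ((3:ℝ) ^ 7 / 2 ^ 11)⁻¹ :=
    Real.one_sub_inv_le_log_of_pos (by norm_num)
  norm_num at h4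
  rw [h2]
  norm_num at h3 ⊢
  linarith

/-- the sign step constant -/
def Lam (n : ℕ) (L M : ℝ) : ℝ :=
  200000 * L * (1 + Real.log M) * Real.sqrt (Real.log n) * Real.sqrt (Real.log (3000 * Real.log n))

set_option maxHeartbeats 2000000 in
lemma BOS.sign_step {Ω : Type*} [MeasurableSpace Ω] {P : Measure Ω} [IsProbabilityMeasure P] {n : ℕ}
    {φ : Fin n → Ω → ℂ} {L : ℝ} (H : BOS P φ L) (hn : 3 ≤ n) (M : ℝ) (hM : 1 ≤ M) (U : ℝ) (hU : 0 < U)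
    (J : Finset (Fin n)) (hTU : ∀ x ∈ TT P φ M, ltwo J (fun j => ‖x j‖) ≤ U) :
    ∃ e : Fin n → Bool, ∀ x ∈ TT P φ M, |Xp J e x| ≤ Lam n L M * U := by
  have hL := H.one
  have hL0 : 0 < L := by linarith
  have hM0 : 0 < M := by linarith
  have hlogM := Real.log_nonneg hM
  have hn3 : (3:ℝ) ≤ n := by exact_mod_cast hn
  have hlogn3 : Real.log 3 ≤ Real.log n := Real.log_le_log (by norm_num) hn3
  have hlogn : 1.09 < Real.log n := lt_of_lt_of_le log_three_gt hlogn3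
  obtain ⟨I, hI1, hI2⟩ := exists_pow_two n (by linarith)
  obtain ⟨K, hK1, hK2⟩ := exists_pow_two (M ^ 2) (by nlinarith)
  rw [Real.log_pow] at hK2
  push_cast at hK2
  have hI : 1 ≤ I := by
    by_contra hc
    have : I = 0 := by omega
    rw [this] at hI1; norm_num at hI1; linarith
  have hIr : (1:ℝ) ≤ I := by exact_mod_cast hI
  have hI25 : (I:ℝ) ≤ 2.5 * Real.log n := by linarith
  set v := 1 + Real.log M with hv
  set w := Real.sqrt v with hw
  have hw2 : w ^ 2 = v := Real.sq_sqrt (by linarith)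
  have hw1 : 1 ≤ w := Real.one_le_sqrt.2 (by linarith)
  set s := Real.sqrt (Real.log n) with hs
  have hs2 : s ^ 2 = Real.log n := Real.sq_sqrt (by linarith)
  have hs1 : 1 ≤ s := Real.one_le_sqrt.2 (by linarith)
  set q := Real.sqrt (Real.log (3000 * Real.log n)) with hq
  have hel : el I ≤ Real.log (3000 * Real.log n) := by
    unfold el
    apply Real.log_le_log (by positivity)
    linarith
  have hqe : Real.sqrt (el I) ≤ q := Real.sqrt_le_sqrt hel
  have hq1 : 1 ≤ q := Real.one_le_sqrt.2 (by have := el_ge hI; linarith)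
  have hR : (K:ℝ) + 2 ≤ 3 * w ^ 2 := by rw [hw2]; linarith
  have hIR : Real.sqrt (I * ((K:ℝ) + 2)) ≤ 3 * w * s := by
    apply Real.sqrt_le_iff.2 ⟨by positivity, ?_⟩
    have : (I:ℝ) * ((K:ℝ) + 2) ≤ (2.5 * s ^ 2) * (3 * w ^ 2) := by
      rw [hs2]; gcongr
    nlinarith [sq_nonneg (w * s)]
  have hqq : Real.sqrt (qq n I) ≤ 3 * s := by
    apply Real.sqrt_le_iff.2 ⟨by positivity, ?_⟩
    unfold qq
    rw [Real.log_mul (by positivity) (by positivity), Real.log_mul (by norm_num) (by positivity)]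
    have h1 : Real.log 100 ≤ 5 * Real.log 3 := by
      have : (5:ℝ) * Real.log 3 = Real.log (3 ^ 5) := by rw [Real.log_pow]; norm_num
      rw [this]
      exact Real.log_le_log (by norm_num) (by norm_num)
    have h2 := Real.log_le_sub_one_of_pos (show (0:ℝ) < I by linarith)
    rw [mul_pow, hs2]
    linarith
  have hzero : (0 : Fin n → ℂ) ∈ TT P φ M := by
    constructor
    · have : none1 P φ (0 : Fin n → ℂ) = 0 := by simp [none1, fa]
      rw [this]; norm_num
    · have : etwo (0 : Fin n → ℂ) = 0 := by simp [etwo, ltwo]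
      rw [this]; linarith
  have hTL : ∀ x ∈ TT P φ M, ∀ j, ‖x j‖ ≤ 9 * L := by
    intro x hx j
    have h1 := H.coef x j
    have h2 := mul_le_mul_of_nonneg_left hx.1 hL0.le
    linarith
  have hN0 : ∀ h, 0 ≤ NN P φ M h := fun h => by
    have := none1_nonneg (P := P) (φ := φ) h
    have := etwo_nonneg h
    unfold NN; positivity
  have hNL : ∀ h j, ‖h j‖ ≤ 9 * L * NN P φ M h := by
    intro h j
    have h1 := H.coef h j
    have h2 : 0 ≤ L * (etwo h / M) := mul_nonneg hL0.le (div_nonneg (etwo_nonneg _) hM0.le)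
    unfold NN
    linarith
  have hNU : ∀ h : Fin n → ℂ, ltwo J (fun j => ‖h j‖) ≤ 9 * U * NN P φ M h := by
    intro h
    set t := none1 P φ h + etwo h / M with ht
    have h1 := none1_nonneg (P := P) (φ := φ) h
    have h2 : 0 ≤ etwo h / M := div_nonneg (etwo_nonneg _) hM0.le
    have eN : 9 * U * NN P φ M h = U * t := by unfold NN; ring
    rw [eN]
    rcases (show 0 ≤ t by positivity).eq_or_lt with h0 | h0
    · have h3 : etwo h / M = 0 := by linarith
      have h4 : etwo h = 0 := by
        rcases div_eq_zero_iff.1 h3 with h | h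
        · exact h
        · linarith
      have h5 : ∀ j, ‖h j‖ = 0 := fun j => le_antisymm (h4 ▸ etwo_coord h j) (norm_nonneg _)
      have : ltwo J (fun j => ‖h j‖) = 0 := by simp [ltwo, h5]
      rw [this, ← h0]; simp
    · have hx : (t⁻¹ • h) ∈ TT P φ M := by
        constructor
        · rw [n1_smul _ (by positivity), inv_mul_le_iff₀ h0]; linarith
        · rw [etwo_smul _ (by positivity), inv_mul_le_iff₀ h0]
          have : etwo h = etwo h / M * M := by field_simp
          rw [this]
          exact mul_le_mul_of_nonneg_right (by linarith) hM0.le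
      have h3 := hTU _ hx
      have e : (fun j => ‖(t⁻¹ • h) j‖) = fun j => t⁻¹ * ‖h j‖ := by
        funext j; simp [abs_of_pos h0]
      rw [e, ltwo_smul _ _ (by positivity), inv_mul_le_iff₀ h0] at h3
      linarith
  have hS : 2 * (9 * L) * (9 * U) ≤ 900 * (L * U) * w := by
    have : 0 < L * U := by positivity
    nlinarith
  obtain ⟨e, he⟩ := process_bound (show 1 ≤ n by omega) hI (by exact_mod_cast hI1) J (TT P φ M)
    (H.T_compact M) (H.T_convex M) hzero (FF P φ M K) (H.F_cont M K) (K + 2) (F_zero M K)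
    (fun x _ => F_nonneg M K x) (fun x hx => H.F_le M hM K x hx) (NN P φ M) hN0
    (fun a ha b hb => H.F_conv M hM K hK1 a b ha hb) (9 * L) (9 * U) (900 * (L * U) * w)
    (by positivity) (by positivity) hS hTL (fun x hx => (hTU x hx).trans (by linarith)) hNL hNU
    (fun z hz => H.bad M hM U hU J z (hTU z hz))
  refine ⟨e, fun x hx => (he x hx).trans ?_⟩
  have hLU : 0 < L * U := by positivity
  have hwsq : w ≤ w ^ 2 * s := by nlinarith [mul_nonneg (sub_nonneg.2 hw1) (sub_nonneg.2 hs1)]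
  calc _ ≤ 50 * (900 * (L * U) * w * q) * (3 * w * s) + 18 * (9 * U * (9 * L * (3 * s))) * (3 * w ^ 2) +
      2 * (900 * (L * U) * w * q) + 2 * (9 * U * (9 * L * (3 * s))) := by gcongr
    _ = (L * U) * (135000 * (w ^ 2 * s * q) + 13122 * (w ^ 2 * s) + 1800 * (w * q) + 486 * s) := by ring
    _ ≤ (L * U) * (200000 * (w ^ 2 * s * q)) := by
        apply mul_le_mul_of_nonneg_left _ hLU.le
        have h1 : w ^ 2 * s ≤ w ^ 2 * s * q := le_mul_of_one_le_right (by positivity) hq1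
        have h2 : w * q ≤ w ^ 2 * s * q := mul_le_mul_of_nonneg_right hwsq (by positivity)
        have h3 : s ≤ w ^ 2 * s := le_mul_of_one_le_left (by positivity) (by nlinarith)
        linarith [show 0 ≤ w ^ 2 * s * q by positivity]
    _ = _ := by unfold Lam; rw [hw2]; ring

end

open MeasureTheory

noncomputable section

lemma half_split {n : ℕ} (J : Finset (Fin n)) (e : Fin n → Bool) :
    ∃ J' : Finset (Fin n), 2 * J'.card ≤ J.card ∧ ∀ a : Fin n → ℂ,
      |2 * ∑ j ∈ J', ‖a j‖ ^ 2 - ∑ j ∈ J, ‖a j‖ ^ 2| = |Xp J e a| := by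
  have hc := Finset.card_filter_add_card_filter_not (s := J) (fun j => e j = true)
  have hs : ∀ a : Fin n → ℂ, ∑ j ∈ J with e j = true, ‖a j‖ ^ 2 + ∑ j ∈ J with ¬ e j = true, ‖a j‖ ^ 2 =
      ∑ j ∈ J, ‖a j‖ ^ 2 := fun a => Finset.sum_filter_add_sum_filter_not _ _ _
  have hX : ∀ a : Fin n → ℂ, Xp J e a = ∑ j ∈ J with e j = true, ‖a j‖ ^ 2 -
      ∑ j ∈ J with ¬ e j = true, ‖a j‖ ^ 2 := by
    intro a
    unfold Xp
    rw [← Finset.sum_filter_add_sum_filter_not J (fun j => e j = true), sub_eq_add_neg,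
      ← Finset.sum_neg_distrib]
    congr 1
    · refine Finset.sum_congr rfl fun j hj => ?_
      rw [(Finset.mem_filter.1 hj).2]; simp [sg]
    · refine Finset.sum_congr rfl fun j hj => ?_
      have := (Finset.mem_filter.1 hj).2
      simp [sg, this]
  rcases le_total (J.filter fun j => e j = true).card (J.filter fun j => ¬ e j = true).card with h | h
  · refine ⟨J.filter fun j => e j = true, by omega, fun a => ?_⟩
    rw [hX, ← hs a]; congr 1; ring
  · refine ⟨J.filter fun j => ¬ e j = true, by omega, fun a => ?_⟩
    rw [hX, ← hs a, ← abs_neg]; congr 1; ring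

lemma BOS.halving {Ω : Type*} [MeasurableSpace Ω] {P : Measure Ω} [IsProbabilityMeasure P] {n : ℕ}
    {φ : Fin n → Ω → ℂ} {L : ℝ} (H : BOS P φ L) (hn : 3 ≤ n) (M : ℝ) (hM : 1 ≤ M) (k : ℕ) (hk : 1 ≤ k)
    (Λ x : ℝ) (hΛ : Λ = Lam n L M) (hΛ0 : 0 < Λ) (hx : x = Real.sqrt ((n:ℝ) / k)) (hMx : 6 * Λ * x ≤ M)
    (i : ℕ) (hi : ∀ i' < i, 2 ^ i' * k ≤ n) :
    ∃ J : Finset (Fin n), 2 ^ i * J.card ≤ n ∧ ∀ a ∈ TT P φ M,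
      |2 ^ i * ∑ j ∈ J, ‖a j‖ ^ 2 - etwo a ^ 2| ≤ 3 * Λ * M * (Real.sqrt (2 ^ i) - 1) := by
  have hM0 : 0 < M := by linarith
  have hk0 : (0:ℝ) < k := by exact_mod_cast hk
  induction i with
  | zero =>
    refine ⟨Finset.univ, by simp, fun a _ => ?_⟩
    rw [etwo_sq]; simp
  | succ i ih =>
    obtain ⟨J, hJ1, hJ2⟩ := ih fun i' hi' => hi i' (by omega)
    have hs : Real.sqrt (2 ^ i) ≤ x := by
      rw [hx]
      apply Real.sqrt_le_sqrt
      rw [le_div_iff₀ hk0]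
      exact_mod_cast hi i (by omega)
    set s := Real.sqrt ((2:ℝ) ^ i) with hsdef
    have hs2 : s ^ 2 = 2 ^ i := Real.sq_sqrt (by positivity)
    have hs0 : 0 < s := Real.sqrt_pos.2 (by positivity)
    have h6 : 6 * Λ * s ≤ M := by
      have := mul_le_mul_of_nonneg_left hs (show 0 ≤ 6 * Λ by positivity)
      linarith
    have hTU : ∀ a ∈ TT P φ M, ltwo J (fun j => ‖a j‖) ≤ 1.225 * M / s := by
      intro a ha
      apply Real.sqrt_le_iff.2 ⟨by positivity, ?_⟩
      have h1 := (abs_le.1 (hJ2 a ha)).2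
      have h2 := pow_le_pow_left₀ (etwo_nonneg a) ha.2 2
      have h3 : 3 * Λ * M * (s - 1) ≤ M ^ 2 / 2 := by
        have : 0 < 3 * Λ * M := by positivity
        nlinarith
      rw [div_pow, le_div_iff₀ (by positivity), hs2]
      nlinarith [sq_nonneg M]
    obtain ⟨e, he⟩ := H.sign_step hn M hM (1.225 * M / s) (by positivity) J hTU
    obtain ⟨J', hc, hJ'⟩ := half_split J e
    refine ⟨J', ?_, fun a ha => ?_⟩
    · calc 2 ^ (i + 1) * J'.card = 2 ^ i * (2 * J'.card) := by ring
        _ ≤ 2 ^ i * J.card := Nat.mul_le_mul_left _ hc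
        _ ≤ n := hJ1
    · have h1 := he a ha
      rw [← hJ' a, ← hΛ] at h1
      have h2 := hJ2 a ha
      have e1 : Real.sqrt ((2:ℝ) ^ (i + 1)) = Real.sqrt 2 * s := by
        rw [pow_succ, mul_comm, Real.sqrt_mul (by norm_num)]
      have hr : 1.4142 ≤ Real.sqrt 2 := Real.le_sqrt_of_sq_le (by norm_num)
      have e2 : (2:ℝ) ^ (i + 1) * ∑ j ∈ J', ‖a j‖ ^ 2 - etwo a ^ 2 =
        2 ^ i * (2 * ∑ j ∈ J', ‖a j‖ ^ 2 - ∑ j ∈ J, ‖a j‖ ^ 2) +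
        (2 ^ i * ∑ j ∈ J, ‖a j‖ ^ 2 - etwo a ^ 2) := by ring
      rw [e1, e2]
      refine (abs_add_le _ _).trans ?_
      rw [abs_mul, abs_of_pos (show (0:ℝ) < 2 ^ i by positivity)]
      have h3 : 2 ^ i * |2 * ∑ j ∈ J', ‖a j‖ ^ 2 - ∑ j ∈ J, ‖a j‖ ^ 2| ≤ 1.225 * Λ * M * s := by
        refine (mul_le_mul_of_nonneg_left h1 (by positivity)).trans (le_of_eq ?_)
        rw [← hs2]; field_simp
      have h4 : 0 < Λ * M * s := by positivity
      have h5 : 1.4142 * (Λ * M * s) ≤ Real.sqrt 2 * (Λ * M * s) := mul_le_mul_of_nonneg_right hr h4.le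
      nlinarith

lemma BOS.main {Ω : Type*} [MeasurableSpace Ω] {P : Measure Ω} [IsProbabilityMeasure P] {n : ℕ}
    {φ : Fin n → Ω → ℂ} {L : ℝ} (H : BOS P φ L) (hn : 3 ≤ n) (M : ℝ) (hM : 1 ≤ M) (k : ℕ) (hk : 1 ≤ k)
    (hkn : k ≤ n) (hΛ0 : 0 < Lam n L M) (hMx : 6 * Lam n L M * Real.sqrt ((n:ℝ) / k) ≤ M) :
    ∃ J : Finset (Fin n), J.card ≤ k ∧ ∀ b : Fin n → ℂ, (∀ j ∈ J, b j = 0) → etwo b ≤ M * none1 P φ b := by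
  classical
  have hM0 : 0 < M := by linarith
  have hk0 : (0:ℝ) < k := by exact_mod_cast hk
  have hex : ∃ i : ℕ, n ≤ 2 ^ i * k := ⟨n, Nat.lt_two_pow_self.le.trans (Nat.le_mul_of_pos_right _ hk)⟩
  set i := Nat.find hex with hi
  have hi1 : n ≤ 2 ^ i * k := Nat.find_spec hex
  have hi2 : ∀ i' < i, 2 ^ i' * k ≤ n := fun i' h => (not_le.1 (Nat.find_min hex h)).le
  obtain ⟨J, hJ1, hJ2⟩ := H.halving hn M hM k hk (Lam n L M) _ rfl hΛ0 rfl hMx i hi2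
  refine ⟨J, ?_, fun b hb => ?_⟩
  · exact Nat.le_of_mul_le_mul_left (hJ1.trans hi1) (by positivity)
  by_contra hcon
  push Not at hcon
  have hb0 : 0 < etwo b := lt_of_le_of_lt (mul_nonneg hM0.le (none1_nonneg _)) hcon
  have hT : (M / etwo b) • b ∈ TT P φ M := by
    constructor
    · rw [n1_smul _ (by positivity), div_mul_eq_mul_div, div_le_one hb0]; exact hcon.le
    · rw [etwo_smul _ (by positivity)]
      exact le_of_eq (by field_simp)
  have h1 := hJ2 _ hT
  have h2 : ∑ j ∈ J, ‖((M / etwo b) • b) j‖ ^ 2 = 0 :=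
    Finset.sum_eq_zero fun j hj => by simp [hb j hj]
  have h3 : etwo ((M / etwo b) • b) = M := by rw [etwo_smul _ (by positivity)]; field_simp
  rw [h2, h3, mul_zero, zero_sub, abs_neg, abs_of_nonneg (sq_nonneg _)] at h1
  have h4 : Real.sqrt ((2:ℝ) ^ i) ≤ 1.5 * Real.sqrt ((n:ℝ) / k) := by
    have h5 : (2:ℝ) ^ i ≤ 2 * ((n:ℝ) / k) := by
      rcases Nat.eq_zero_or_pos i with h0 | h0
      · rw [h0, pow_zero, ← mul_div_assoc, le_div_iff₀ hk0]
        have : (k:ℝ) ≤ n := by exact_mod_cast hkn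
        linarith
      · have h6 := hi2 (i - 1) (by omega)
        have h7 : (2:ℝ) ^ (i - 1) * k ≤ n := by exact_mod_cast h6
        have h8 : (2:ℝ) ^ i = 2 * 2 ^ (i - 1) := by rw [← pow_succ']; congr 1; omega
        rw [h8]
        have : (2:ℝ) ^ (i - 1) ≤ n / k := by rw [le_div_iff₀ hk0]; exact h7
        linarith
    apply Real.sqrt_le_iff.2 ⟨by positivity, ?_⟩
    rw [mul_pow, Real.sq_sqrt (by positivity)]
    have : 0 ≤ (n:ℝ) / k := by positivity
    linarith
  set Λ := Lam n L M
  set x := Real.sqrt ((n:ℝ) / k)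
  have h5 : 3 * Λ * (Real.sqrt ((2:ℝ) ^ i) - 1) < M := by nlinarith
  nlinarith

end

open MeasureTheory

noncomputable section

set_option maxHeartbeats 1000000 in
lemma num_final (n k : ℕ) (hk : 2 ≤ k) (hkn : k < n) (L μ M : ℝ) (hL : 1 ≤ L)
    (hμ : μ = L * Real.sqrt ((n:ℝ) / k) * Real.sqrt (Real.log k))
    (hM : M = 10 ^ 10 * μ * (max (Real.log μ) 1) ^ ((5:ℝ) / 2)) :
    1 ≤ M ∧ 0 < Lam n L M ∧ 6 * Lam n L M * Real.sqrt ((n:ℝ) / k) ≤ M := by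
  have hk2 : (2:ℝ) ≤ k := by exact_mod_cast hk
  have hkn' : (k:ℝ) ≤ n := by exact_mod_cast hkn.le
  have hk0 : (0:ℝ) < k := by linarith
  have hn0 : (0:ℝ) < n := by linarith
  set l := Real.log k with hl
  have hl1 : 0.693 ≤ l := by
    have h1 := Real.log_two_gt_d9
    have h2 := Real.log_le_log (by norm_num) hk2
    linarith
  set y := (n:ℝ) / k with hy
  have hy1 : 1 ≤ y := by rw [hy, le_div_iff₀ hk0]; linarith
  have hL0 : 0 < L := by linarith
  have hsy : 1 ≤ Real.sqrt y := Real.one_le_sqrt.2 hy1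
  have hsl : 0.8 ≤ Real.sqrt l := Real.le_sqrt_of_sq_le (by norm_num; linarith)
  have hμ8 : 0.8 ≤ μ := by
    rw [hμ]
    have : 1 ≤ L * Real.sqrt y := one_le_mul_of_one_le_of_one_le hL hsy
    nlinarith
  have hμ0 : 0 < μ := by linarith
  set m := max (Real.log μ) 1 with hm
  have hm1 : 1 ≤ m := le_max_right _ _
  have hm0 : 0 < m := by linarith
  have hlm : Real.log μ ≤ m := le_max_left _ _
  have hlogμ : Real.log μ = Real.log L + Real.log y / 2 + Real.log l / 2 := by
    rw [hμ, Real.log_mul (by positivity) (by positivity), Real.log_mul (by positivity) (by positivity),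
      Real.log_sqrt (by linarith), Real.log_sqrt (by linarith)]
  have hlL := Real.log_nonneg hL
  have hly := Real.log_nonneg hy1
  have hll : -0.45 ≤ Real.log l := by
    have := Real.one_sub_inv_le_log_of_pos (show 0 < l by linarith)
    have h2 : l⁻¹ ≤ (0.693)⁻¹ := inv_anti₀ (by norm_num) hl1
    norm_num at h2
    norm_num
    linarith
  have hly2 : Real.log y ≤ 2.45 * m := by linarith
  have hll2 : Real.log l ≤ 2 * m := by linarith
  have hlogn : Real.log n = l + Real.log y := by
    rw [hy, Real.log_div (by positivity) (by positivity)]; ring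
  have hlogn1 : Real.log n ≤ 4.6 * (l * m) := by
    rw [hlogn]; nlinarith
  have hlogn0 : 0.693 ≤ Real.log n := by linarith
  have hlln : Real.log (3000 * Real.log n) ≤ 13 * m := by
    have h1 : Real.log (3000 * Real.log n) ≤ Real.log (13800 * (l * m)) :=
      Real.log_le_log (by positivity) (by linarith)
    have h1' : Real.log (13800 * (l * m)) = Real.log 13800 + (Real.log l + Real.log m) := by
      rw [Real.log_mul (by norm_num) (by positivity), Real.log_mul (by positivity) (by positivity)]
    rw [h1'] at h1
    have h2 : Real.log 13800 ≤ 10 := by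
      rw [Real.log_le_iff_le_exp (by norm_num)]
      have h3 := Real.exp_one_gt_d9
      have : Real.exp 10 = Real.exp 1 ^ 10 := by rw [← Real.exp_nat_mul]; norm_num
      rw [this]
      calc (13800:ℝ) ≤ 2.7 ^ 10 := by norm_num
        _ ≤ _ := pow_le_pow_left₀ (by norm_num) (by linarith) 10
    have h3 := Real.log_le_sub_one_of_pos hm0
    linarith
  have hlln0 : 0 < Real.log (3000 * Real.log n) := Real.log_pos (by linarith)
  have hmp : m ^ 2 ≤ m ^ ((5:ℝ) / 2) := by
    rw [← Real.rpow_natCast]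
    exact Real.rpow_le_rpow_of_exponent_le hm1 (by norm_num)
  have hM1 : 1 ≤ M := by
    rw [hM]
    have h1 : 1 ≤ m ^ ((5:ℝ) / 2) := by nlinarith
    nlinarith
  have hv : 1 + Real.log M ≤ 100 * m := by
    rw [hM, Real.log_mul (by positivity) (by positivity), Real.log_mul (by positivity) (by positivity),
      Real.log_rpow hm0, Real.log_pow]
    have h3 := Real.log_le_sub_one_of_pos hm0
    have h4 := Real.log_le_sub_one_of_pos (show (0:ℝ) < 10 by norm_num)
    push_cast
    linarith
  have hv0 : 1 ≤ 1 + Real.log M := by have := Real.log_nonneg hM1; linarith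
  refine ⟨hM1, ?_, ?_⟩
  · unfold Lam
    have h1 := Real.sqrt_pos.2 (show 0 < Real.log n by linarith)
    have h2 := Real.sqrt_pos.2 hlln0
    positivity
  · have e1 : Real.sqrt (Real.log n) * Real.sqrt (Real.log (3000 * Real.log n)) ≤ 8 * (Real.sqrt l * m) := by
      rw [← Real.sqrt_mul (by linarith)]
      apply Real.sqrt_le_iff.2 ⟨by positivity, ?_⟩
      rw [mul_pow, mul_pow, Real.sq_sqrt (by linarith)]
      have : Real.log n * Real.log (3000 * Real.log n) ≤ (4.6 * (l * m)) * (13 * m) := by gcongr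
      nlinarith [show 0 ≤ l * m ^ 2 by positivity]
    unfold Lam
    calc _ = 1200000 * (L * Real.sqrt y) * (1 + Real.log M) *
          (Real.sqrt (Real.log n) * Real.sqrt (Real.log (3000 * Real.log n))) := by ring
      _ ≤ 1200000 * (L * Real.sqrt y) * (100 * m) * (8 * (Real.sqrt l * m)) := by gcongr
      _ = 960000000 * (L * Real.sqrt y * Real.sqrt l) * m ^ 2 := by ring
      _ ≤ 10 ^ 10 * (L * Real.sqrt y * Real.sqrt l) * m ^ ((5:ℝ) / 2) := by
        gcongr
        norm_num
      _ = M := by rw [hM, ← hμ]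

end

open MeasureTheory

noncomputable section

lemma eLp_two {Ω : Type*} [MeasurableSpace Ω] (P : Measure Ω) [IsProbabilityMeasure P] (f : Ω → ℂ)
    (hf : Measurable f) (C : ℝ) (hC : ∀ ω, ‖f ω‖ ≤ C) :
    eLpNorm f 2 P = ENNReal.ofReal (Real.sqrt (∫ ω, ‖f ω‖ ^ 2 ∂P)) := by
  have h : MemLp f 2 P := MemLp.of_bound hf.aestronglyMeasurable C (Filter.Eventually.of_forall hC)
  rw [h.eLpNorm_eq_integral_rpow_norm (by norm_num) (by norm_num)]
  congr 1
  simp only [ENNReal.toReal_ofNat, Real.rpow_ofNat]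
  rw [Real.sqrt_eq_rpow]; norm_num

lemma eLp_one {Ω : Type*} [MeasurableSpace Ω] (P : Measure Ω) [IsProbabilityMeasure P] (f : Ω → ℂ)
    (hf : Integrable f P) :
    eLpNorm f 1 P = ENNReal.ofReal (∫ ω, ‖f ω‖ ∂P) := by
  rw [eLpNorm_one_eq_lintegral_enorm, ofReal_integral_norm_eq_lintegral_enorm hf]

lemma exists_bos {Ω : Type*} [MeasurableSpace Ω] (P : Measure Ω) [IsProbabilityMeasure P]
    (n : ℕ) (hn : 1 ≤ n) (φ : Fin n → Ω → ℂ) (L : ℝ) (hm : ∀ j, AEStronglyMeasurable (φ j) P)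
    (ho : ∀ i j, (∫ ω, (starRingEnd ℂ) (φ i ω) * φ j ω ∂P) = if i = j then 1 else 0)
    (hL : ∀ j, ∀ᵐ ω ∂P, ‖φ j ω‖ ≤ L) :
    ∃ ψ : Fin n → Ω → ℂ, BOS P ψ L ∧ ∀ j, φ j =ᵐ[P] ψ j := by
  classical
  have hLnn : 0 ≤ L := by
    obtain ⟨ω, hω⟩ := (hL ⟨0, hn⟩).exists
    exact (norm_nonneg _).trans hω
  set ψ : Fin n → Ω → ℂ := fun j ω => if ‖(hm j).mk (φ j) ω‖ ≤ L then (hm j).mk (φ j) ω else 0 with hψ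
  have hmk : ∀ j, Measurable ((hm j).mk (φ j)) := fun j => (hm j).stronglyMeasurable_mk.measurable
  have hae : ∀ j, φ j =ᵐ[P] ψ j := by
    intro j
    filter_upwards [(hm j).ae_eq_mk, hL j] with ω h1 h2
    simp only [hψ]
    rw [← h1, if_pos h2]
  have hbd : ∀ j ω, ‖ψ j ω‖ ≤ L := by
    intro j ω
    simp only [hψ]
    split_ifs with h
    · exact h
    · simpa using hLnn
  have hme : ∀ j, Measurable (ψ j) := fun j =>
    Measurable.ite (measurableSet_le (hmk j).norm measurable_const) (hmk j) measurable_const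
  have hor : ∀ i j, (∫ ω, (starRingEnd ℂ) (ψ i ω) * ψ j ω ∂P) = if i = j then 1 else 0 := by
    intro i j
    rw [← ho i j]
    apply integral_congr_ae
    filter_upwards [hae i, hae j] with ω h1 h2
    rw [h1, h2]
  refine ⟨ψ, ⟨hme, hbd, hor, ?_⟩, hae⟩
  have h1 := hor ⟨0, hn⟩ ⟨0, hn⟩
  rw [if_pos rfl] at h1
  have h2 := norm_integral_le_of_norm_le_const (μ := P) (C := L * L)
    (f := fun ω => (starRingEnd ℂ) (ψ ⟨0, hn⟩ ω) * ψ ⟨0, hn⟩ ω) (Filter.Eventually.of_forall fun ω => by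
      rw [norm_mul, RCLike.norm_conj]
      exact mul_le_mul (hbd _ ω) (hbd _ ω) (norm_nonneg _) hLnn)
  rw [h1] at h2
  simp at h2
  nlinarith

end

open MeasureTheory

/-- selection of a subset of cardinality at least `n − k` of a bounded orthonormal
system on which the `L₂` and `L₁` norms are equivalent up to `C μ (max(log μ, 1))^{5/2}`
with `μ = L √(n/k) √(log k)`. -/
theorem stmt8 :
    ∃ C : ℝ, 0 < C ∧
      ∀ (Ω : Type*) [MeasurableSpace Ω] (P : Measure Ω) [IsProbabilityMeasure P]
        (n : ℕ) (φ : Fin n → Ω → ℂ) (L : ℝ),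
        (∀ j, AEStronglyMeasurable (φ j) P) →
        (∀ i j, (∫ ω, (starRingEnd ℂ) (φ i ω) * φ j ω ∂P) = if i = j then 1 else 0) →
        (∀ j, ∀ᵐ ω ∂P, ‖φ j ω‖ ≤ L) →
        ∀ k : ℕ, 2 ≤ k → k < n →
        ∀ μ : ℝ, μ = L * Real.sqrt ((n : ℝ) / k) * Real.sqrt (Real.log k) →
        ∃ I : Finset (Fin n), n - k ≤ I.card ∧
          ∀ a : Fin n → ℂ,
            eLpNorm (fun ω => ∑ i ∈ I, a i * φ i ω) 2 P ≤
              ENNReal.ofReal (C * μ * max (Real.log μ) 1 ^ ((5 : ℝ) / 2)) *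
                eLpNorm (fun ω => ∑ i ∈ I, a i * φ i ω) 1 P := by
  refine ⟨10 ^ 10, by norm_num, ?_⟩
  intro Ω _ P _ n φ L hm ho hL k hk hkn μ hμ
  classical
  obtain ⟨ψ, H, hae⟩ := exists_bos P n (by omega) φ L hm ho hL
  set M := 10 ^ 10 * μ * max (Real.log μ) 1 ^ ((5 : ℝ) / 2) with hM
  obtain ⟨hM1, hΛ, hMx⟩ := num_final n k hk hkn L μ M H.one hμ hM
  obtain ⟨J, hJ1, hJ2⟩ := H.main (by omega) M hM1 k (by omega) hkn.le hΛ hMx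
  refine ⟨Jᶜ, ?_, fun a => ?_⟩
  · rw [Finset.card_compl, Fintype.card_fin]; omega
  set b : Fin n → ℂ := fun j => if j ∈ Jᶜ then a j else 0 with hb
  have hcong : (fun ω => ∑ i ∈ Jᶜ, a i * φ i ω) =ᵐ[P] fa ψ b := by
    have hall : ∀ᵐ ω ∂P, ∀ j, φ j ω = ψ j ω := ae_all_iff.2 hae
    filter_upwards [hall] with ω hω
    simp only [fa, hb, ite_mul, zero_mul]
    rw [Finset.sum_ite_mem, Finset.univ_inter]
    exact Finset.sum_congr rfl fun j _ => by rw [hω]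
  rw [eLpNorm_congr_ae hcong, eLpNorm_congr_ae hcong, eLp_two P _ (H.fmeas b) _ (H.fbd b),
    eLp_one P _ (H.fint b), H.l2, Real.sqrt_sq (etwo_nonneg _), ← ENNReal.ofReal_mul (by linarith)]
  apply ENNReal.ofReal_le_ofReal
  exact hJ2 b fun j hj => by simp [hb, hj]
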